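/- Let m ≥ 1, p = 5, p1 = 499, N = 499^m, and q = 5^{249·499^{m−1}}. Then for every k with 0 ≤ k ≤ 498, the Cayley graph Cay(F_q, D_k) is a strongly regular graph of degree (q−1)/499, where D_k = ∪_{i=0}^{499^{m−1}−1} C_{i + k·499^{m−1}}. -/

import Mathlib

open scoped Classical

noncomputable section

theorem WittVector.charZero_of_field (p : ℕ) [Fact p.Prime] (F : Type) [Field F] [CharP F p]
    [PerfectRing F p] : CharZero (WittVector p F) := by
  have hp : (p : WittVector p F) ≠ 0 := (WittVector.irreducible p).ne_zero
  obtain ⟨l, hl⟩ := CharP.exists (WittVector p F)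
  rcases CharP.char_is_prime_or_zero (WittVector p F) l with h | rfl
  · exfalso
    have h1 : ((l : ℕ) : F) = 0 := by
      have := congrArg (WittVector.constantCoeff (p := p) (R := F)) (CharP.cast_eq_zero (WittVector p F) l)
      rwa [map_natCast, map_zero] at this
    rw [CharP.cast_eq_zero_iff F p] at h1
    have := (Nat.prime_dvd_prime_iff_eq Fact.out h).mp h1
    subst this
    exact hp (CharP.cast_eq_zero _ _)
  · exact CharP.charP_to_charZero _

/-- A finite field of characteristic `p` admits a Teichmüller lift to a local domain of
characteristic zero containing the `p`-th roots of unity. -/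
theorem exists_teichmuller_lift (p : ℕ) [Fact p.Prime] (F : Type) [Field F] [Finite F] [CharP F p] :
    ∃ (R : Type) (_ : CommRing R) (_ : IsDomain R) (_ : IsLocalRing R) (_ : CharZero R)
      (ζ : R) (ω : F →* R) (ι : F →+* IsLocalRing.ResidueField R),
      IsPrimitiveRoot ζ p ∧ ω 0 = 0 ∧ ∀ x, IsLocalRing.residue R (ω x) = ι x := by
  let W := WittVector p F
  have : CharZero W := WittVector.charZero_of_field p F
  let K := AlgebraicClosure (FractionRing W)
  have : CharZero (FractionRing W) := charZero_of_injective_algebraMap (IsFractionRing.injective W _)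
  have : CharZero K := charZero_of_injective_algebraMap (algebraMap (FractionRing W) K).injective
  let f : W →+* K := (algebraMap (FractionRing W) K).comp (algebraMap W (FractionRing W))
  obtain ⟨A, hA, hloc⟩ := IsLocalRing.exists_factor_valuationRing f
  let g : W →+* A := f.codRestrict A.toSubring hA
  have : IsLocalHom g := hloc
  have : NeZero (p : K) := ⟨Nat.cast_ne_zero.mpr (Fact.out : p.Prime).ne_zero⟩
  obtain ⟨ζ, hζ⟩ := HasEnoughRootsOfUnity.exists_primitiveRoot K p
  have hζA : ζ ∈ A := by
    rcases A.mem_or_inv_mem ζ with h | h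
    · exact h
    · have : ζ = ζ⁻¹ ^ (p - 1) := by
        have h0 : ζ ≠ 0 := hζ.ne_zero (Fact.out : p.Prime).ne_zero
        have h1 := hζ.pow_eq_one
        rw [inv_pow, ← mul_eq_one_iff_eq_inv₀ (pow_ne_zero _ h0), ← pow_succ',
          Nat.sub_add_cancel (Fact.out : p.Prime).one_le, h1]
      rw [this]
      exact pow_mem h _
  have : CharZero A := charZero_of_injective_algebraMap (R := ℤ) (algebraMap ℤ A).injective_int
  have hker : RingHom.ker (WittVector.constantCoeff (p := p) (R := F)) ≤
      RingHom.ker ((IsLocalRing.residue A).comp g) := by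
    intro x hx
    rw [RingHom.mem_ker] at hx ⊢
    rw [RingHom.comp_apply, IsLocalRing.residue_eq_zero_iff, IsLocalRing.mem_maximalIdeal,
      mem_nonunits_iff]
    intro hu
    have := (isUnit_of_map_unit g x hu).map (WittVector.constantCoeff (p := p) (R := F))
    rw [hx] at this
    exact not_isUnit_zero this
  let ι : F →+* IsLocalRing.ResidueField A :=
    WittVector.constantCoeff.liftOfSurjective (WittVector.constantCoeff_surjective p)
      ⟨(IsLocalRing.residue A).comp g, hker⟩
  refine ⟨A, inferInstance, inferInstance, inferInstance, inferInstance, ⟨ζ, hζA⟩,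
    (g : W →* A).comp (WittVector.teichmuller p), ι, ?_, ?_, fun x => ?_⟩
  · exact IsPrimitiveRoot.of_map_of_injective (f := A.subtype) (by exact hζ) Subtype.val_injective
  · change g (WittVector.teichmuller p 0) = 0
    rw [WittVector.teichmuller_zero, map_zero]
  · have := RingHom.liftOfRightInverse_comp_apply
      (WittVector.constantCoeff (p := p) (R := F)) _
      (Function.rightInverse_surjInv (WittVector.constantCoeff_surjective p))
      ⟨(IsLocalRing.residue A).comp g, hker⟩ (WittVector.teichmuller p x)
    exact this.symm

section StickelbergerBound

open IsLocalRing

variable {p : ℕ} [Fact p.Prime] {F : Type} [Field F] [Algebra (ZMod p) F]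
  {R : Type} [CommRing R]

/-- The additive character `x ↦ ζ ^ Tr x` of a finite field. -/
def traceChar (F : Type) [Field F] [Algebra (ZMod p) F] {ζ : R} (hζ : ζ ^ p = 1) : AddChar F R :=
  (AddChar.zmodChar p hζ).compAddMonoidHom (Algebra.trace (ZMod p) F).toAddMonoidHom

theorem traceChar_apply {ζ : R} (hζ : ζ ^ p = 1) (x : F) :
    traceChar F hζ x = ζ ^ (Algebra.trace (ZMod p) F x).val := rfl

/-- The multiplicative character `x ↦ ω x⁻¹` attached to a multiplicative map `ω`. -/
def invChar (ω : F →* R) (h0 : ω 0 = 0) : MulChar F R where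
  toFun x := ω x⁻¹
  map_one' := by simp
  map_mul' x y := by simp [mul_comm]
  map_nonunit' x hx := by
    rw [isUnit_iff_ne_zero, not_not] at hx
    simp [hx, h0]

theorem invChar_apply (ω : F →* R) (h0 : ω 0 = 0) (x : F) : invChar ω h0 x = ω x⁻¹ := rfl

theorem residue_sub_one [IsLocalRing R] {ζ : R} (ι : F →+* ResidueField R) (hζ : ζ ^ p = 1) : residue R (ζ - 1) = 0 := by
  have : CharP F p := charP_of_injective_algebraMap (algebraMap (ZMod p) F).injective p
  have : CharP (ResidueField R) p := charP_of_injective_ringHom ι.injective p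
  rw [map_sub, map_one]
  apply eq_zero_of_pow_eq_zero (n := p)
  rw [sub_pow_char, ← map_pow, hζ, map_one, one_pow, sub_self]

theorem invChar_pow_ne_one [IsLocalRing R] (ω : F →* R) (h0 : ω 0 = 0) (ι : F →+* ResidueField R)
    (hι : ∀ x, residue R (ω x) = ι x)
    (γ : Fˣ) {n : ℕ} (hn : 0 < n) (hγ : n < orderOf γ) :
    invChar ω h0 ^ n ≠ 1 := by
  intro h
  have h1 := DFunLike.congr_fun h (γ : F)
  rw [MulChar.pow_apply' _ hn.ne', MulChar.one_apply_coe, invChar_apply] at h1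
  have h2 := congrArg (residue R) h1
  rw [map_pow, hι, map_one, ← map_pow, map_eq_one_iff _ ι.injective, inv_pow, inv_eq_one] at h2
  have h3 : γ ^ n = 1 := Units.ext (by simpa using h2)
  exact absurd (Nat.le_of_dvd hn (orderOf_dvd_of_pow_eq_one h3)) (not_le.mpr hγ)

variable [Fintype F]

theorem trace_pow_char (x : F) :
    Algebra.trace (ZMod p) F (x ^ p) = Algebra.trace (ZMod p) F x := by
  have h := Algebra.trace_eq_of_algEquiv
    (FiniteField.frobeniusAlgEquivOfAlgebraic (ZMod p) F) x
  rwa [FiniteField.coe_frobeniusAlgEquivOfAlgebraic, ZMod.card] at h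

theorem traceChar_isPrimitive {ζ : R} (hζ : IsPrimitiveRoot ζ p) :
    (traceChar F hζ.pow_eq_one).IsPrimitive := by
  apply AddChar.IsPrimitive.of_ne_one
  obtain ⟨x, hx⟩ := Algebra.trace_surjective (ZMod p) F 1
  intro h
  have h1 := DFunLike.congr_fun h x
  rw [traceChar_apply, hx, ZMod.val_one, pow_one, AddChar.one_apply] at h1
  exact hζ.ne_one (Fact.out : p.Prime).one_lt h1

theorem frobenius_bijective_of_finite : Function.Bijective (fun x : F => x ^ p) := by
  have := (FiniteField.frobeniusAlgEquivOfAlgebraic (ZMod p) F).bijective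
  rwa [FiniteField.coe_frobeniusAlgEquivOfAlgebraic, ZMod.card] at this

theorem gaussSum_pow_char_traceChar {ζ : R} (hζ : ζ ^ p = 1) (χ : MulChar F R) :
    gaussSum (χ ^ p) (traceChar F hζ) = gaussSum χ (traceChar F hζ) := by
  unfold gaussSum
  refine Function.Bijective.sum_comp (frobenius_bijective_of_finite (p := p))
    (fun x => χ x * traceChar F hζ x) ▸ Finset.sum_congr rfl fun x _ => ?_
  rw [MulChar.pow_apply' _ (Fact.out : p.Prime).ne_zero, map_pow, traceChar_apply,
    traceChar_apply, trace_pow_char]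

theorem gaussSum_pow_char_pow_traceChar {ζ : R} (hζ : ζ ^ p = 1) (χ : MulChar F R) (i : ℕ) :
    gaussSum (χ ^ p ^ i) (traceChar F hζ) = gaussSum χ (traceChar F hζ) := by
  induction i with
  | zero => simp
  | succ i ih => rw [pow_succ, pow_mul, gaussSum_pow_char_traceChar, ih]

theorem exists_one_add_pow_eq (π : R) (n : ℕ) : ∃ c, (1 + π) ^ n = 1 + n * π + π ^ 2 * c := by
  induction n with
  | zero => exact ⟨0, by simp⟩
  | succ n ih =>
    obtain ⟨c, hc⟩ := ih
    exact ⟨c * (1 + π) + n, by rw [pow_succ, hc]; push_cast; ring⟩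

theorem sum_inv_mul_trace :
    ∑ x : F, x⁻¹ * algebraMap (ZMod p) F (Algebra.trace (ZMod p) F x) = -1 := by
  have hcard : Fintype.card F = p ^ Module.finrank (ZMod p) F := by
    rw [Module.card_eq_pow_finrank (K := ZMod p), ZMod.card]
  have hp := (Fact.out : p.Prime)
  have hpos : 0 < Module.finrank (ZMod p) F := Module.finrank_pos
  simp_rw [FiniteField.algebraMap_trace_eq_sum_pow, Finset.mul_sum, Nat.card_zmod]
  rw [Finset.sum_comm, ← Nat.sub_add_cancel hpos, Finset.sum_range_succ',
    Finset.sum_eq_zero, zero_add]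
  · have h1 : ∀ x : F, x⁻¹ * x ^ p ^ 0 = 1 - if x = 0 then 1 else 0 := by
      intro x
      by_cases hx : x = 0 <;> simp [hx]
    simp_rw [h1]
    rw [Finset.sum_sub_distrib]
    simp
  · intro i hi
    rw [Finset.mem_range] at hi
    have h2 : 1 < p ^ (i + 1) := Nat.one_lt_pow (Nat.succ_ne_zero _) hp.one_lt
    have h3 : p ^ (i + 1) < Fintype.card F := by
      rw [hcard]
      exact Nat.pow_lt_pow_right hp.one_lt (by omega)
    rw [← FiniteField.sum_pow_lt_card_sub_one F (p ^ (i + 1) - 1) (by omega)]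
    refine Finset.sum_congr rfl fun x _ => ?_
    by_cases hx : x = 0
    · subst hx
      rw [inv_zero, zero_mul, zero_pow (by omega)]
    · rw [inv_mul_eq_iff_eq_mul₀ hx, ← pow_succ', Nat.sub_add_cancel h2.le]

variable [IsDomain R] [IsLocalRing R] {ζ : R}

theorem gaussSum_invChar_eq (ω : F →* R) (h0 : ω 0 = 0) (ι : F →+* ResidueField R)
    (hι : ∀ x, residue R (ω x) = ι x)
    (hζ : ζ ^ p = 1) (hω : invChar ω h0 ≠ 1) :
    ∃ u : R, IsUnit u ∧ gaussSum (invChar ω h0) (traceChar F hζ) = (ζ - 1) * u := by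
  choose c hc using exists_one_add_pow_eq (ζ - 1)
  let t : F → ℕ := fun x => (Algebra.trace (ZMod p) F x).val
  refine ⟨∑ x, invChar ω h0 x * (t x + (ζ - 1) * c (t x)), ?_, ?_⟩
  · rw [← residue_ne_zero_iff_isUnit, map_sum]
    have : ∀ x, residue R (invChar ω h0 x * (t x + (ζ - 1) * c (t x))) =
        ι (x⁻¹ * algebraMap (ZMod p) F (Algebra.trace (ZMod p) F x)) := by
      intro x
      rw [map_mul, map_add, map_mul, residue_sub_one ι hζ, invChar_apply, hι, zero_mul, add_zero,
        map_mul, map_natCast]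
      congr 1
      conv_rhs => rw [← ZMod.natCast_zmod_val (Algebra.trace (ZMod p) F x)]
      rw [map_natCast, map_natCast]
    simp_rw [this]
    rw [← map_sum, sum_inv_mul_trace, map_neg, map_one]
    exact neg_ne_zero.mpr one_ne_zero
  · have h1 : ∀ x, invChar ω h0 x * traceChar F hζ x = invChar ω h0 x +
        (ζ - 1) * (invChar ω h0 x * (t x + (ζ - 1) * c (t x))) := by
      intro x
      have := hc (t x)
      rw [add_sub_cancel] at this
      rw [traceChar_apply, this]
      ring
    unfold gaussSum
    simp_rw [h1]
    rw [Finset.sum_add_distrib, MulChar.sum_eq_zero_of_ne_one hω, zero_add, Finset.mul_sum]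

/-- The upper bound half of Stickelberger's theorem on the valuation of Gauss sums. -/
theorem gaussSum_invChar_pow_dvd (ω : F →* R) (h0 : ω 0 = 0) (ι : F →+* ResidueField R)
    (hι : ∀ x, residue R (ω x) = ι x)
    (hζ : ζ ^ p = 1) (γ : Fˣ) (s : Multiset ℕ) (hs : s ≠ 0)
    (hlt : (s.map (p ^ ·)).sum < orderOf γ) :
    gaussSum (invChar ω h0 ^ (s.map (p ^ ·)).sum) (traceChar F hζ) ∣ (ζ - 1) ^ s.card := by
  have hp := (Fact.out : p.Prime)
  induction s using Multiset.induction with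
  | empty => exact absurd rfl hs
  | cons a s ih =>
    rw [Multiset.map_cons, Multiset.sum_cons] at hlt ⊢
    have hpa : 0 < p ^ a := pow_pos hp.pos _
    obtain ⟨u, hu, hg⟩ := gaussSum_invChar_eq ω h0 ι hι hζ
      (by simpa using invChar_pow_ne_one ω h0 ι hι γ one_pos (by omega))
    have hdvd : gaussSum (invChar ω h0 ^ p ^ a) (traceChar F hζ) ∣ ζ - 1 := by
      rw [gaussSum_pow_char_pow_traceChar, hg]
      exact hu.mul_right_dvd.mpr dvd_rfl
    rcases eq_or_ne s 0 with rfl | hs0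
    · simpa using hdvd
    · have hne : invChar ω h0 ^ p ^ a * invChar ω h0 ^ (s.map (p ^ ·)).sum ≠ 1 := by
        rw [← pow_add]
        exact invChar_pow_ne_one ω h0 ι hι γ (by omega) hlt
      rw [pow_add, Multiset.card_cons, pow_succ']
      exact (Dvd.intro _ (jacobiSum_mul_nontrivial hne _)).trans
        (mul_dvd_mul hdvd (ih hs0 (by omega)))

end StickelbergerBound

section Arithmetic

theorem sum_range_mul_eq {α : Type} [AddCommMonoid α] (f : ℕ → α) (a b : ℕ) :
    ∑ x ∈ Finset.range (a * b), f x =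
      ∑ i ∈ Finset.range a, ∑ j ∈ Finset.range b, f (b * i + j) := by
  induction a with
  | zero => simp
  | succ a ih => rw [Nat.succ_mul, Finset.sum_range_add, ih, Finset.sum_range_succ, mul_comm a b]

theorem sum_squares_mod : ∑ j ∈ Finset.range 499, (if j ^ 249 % 499 = 1 then j else 0) = 61377 := by
  decide +kernel

theorem card_squares_mod : ∑ j ∈ Finset.range 499, (if j ^ 249 % 499 = 1 then 1 else 0) = 249 := by
  decide +kernel

theorem mod_eq_zero_or_square_or_neg_square : ∀ c < 499,
    c = 0 ∨ c ^ 249 % 499 = 1 ∨ (499 - c) ^ 249 % 499 = 1 := by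
  decide +kernel

theorem sum_squares_range (M : ℕ) :
    2 * ∑ x ∈ Finset.range (M * 499), (if x ^ 249 % 499 = 1 then x else 0) + 1497 * M =
      124251 * M ^ 2 := by
  rw [sum_range_mul_eq]
  have h : ∀ i, ∑ j ∈ Finset.range 499, (if (499 * i + j) ^ 249 % 499 = 1 then 499 * i + j else 0) =
      499 * i * 249 + 61377 := by
    intro i
    have h1 := congrArg (499 * i * ·) card_squares_mod
    beta_reduce at h1
    rw [← h1, ← sum_squares_mod, Finset.mul_sum, ← Finset.sum_add_distrib]
    refine Finset.sum_congr rfl fun j _ => ?_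
    rw [Nat.pow_mod, Nat.mul_add_mod, ← Nat.pow_mod]
    split_ifs <;> simp
  simp_rw [h]
  induction M with
  | zero => simp
  | succ M ih => rw [Finset.sum_range_succ]; linarith

theorem card_squares_range (M : ℕ) :
    ((Finset.range (M * 499)).filter (fun x => x ^ 249 % 499 = 1)).card = M * 249 := by
  rw [Finset.card_filter, sum_range_mul_eq]
  simp_rw [Nat.pow_mod (499 * _ + _), Nat.mul_add_mod, ← Nat.pow_mod]
  rw [Finset.sum_congr rfl fun _ _ => card_squares_mod]
  simp

instance : Fact (Nat.Prime 499) := ⟨by norm_num⟩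

theorem orderOf_five_pow (n : ℕ) : orderOf ((5 : ZMod (499 ^ (n + 1))) ^ 249) = 499 ^ n := by
  obtain ⟨a, ha⟩ : (499 : ℤ) ∣ 5 ^ 249 - 1 := by norm_num
  have ha1 : ¬ ((499 : ℕ) : ℤ) ∣ a := by
    rintro ⟨b, rfl⟩
    have : (499 ^ 2 : ℤ) ∣ 5 ^ 249 - 1 := ⟨b, by rw [ha]; push_cast; ring⟩
    norm_num at this
  have h : 1 + a * 499 = (5 : ℤ) ^ 249 := by linarith
  have h1 := ZMod.orderOf_one_add_mul_prime (p := 499) (by norm_num) (by norm_num)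
    a ha1 n
  rw [← h1]
  congr 1
  have := congrArg (Int.cast : ℤ → ZMod (499 ^ (n + 1))) h
  simp only [Int.cast_add, Int.cast_one, Int.cast_mul, Int.cast_pow, Int.cast_ofNat] at this
  rw [← this, Nat.cast_ofNat, mul_comm]

theorem orderOf_five (n : ℕ) : orderOf (5 : ZMod (499 ^ (n + 1))) = 249 * 499 ^ n := by
  have h1 := orderOf_five_pow n
  have h0 : (5 : ZMod (499 ^ (n + 1))) ^ (249 * 499 ^ n) = 1 := by
    rw [pow_mul, ← h1, pow_orderOf_eq_one]
  have hdvd : 249 ∣ orderOf (5 : ZMod (499 ^ (n + 1))) := by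
    have h2 : orderOf (5 : ZMod 499) = 249 := by
      refine orderOf_eq_of_pow_and_pow_div_prime (by norm_num) (by decide +kernel) ?_
      intro p hp hd
      have : p ∈ Nat.primeFactorsList 249 := (Nat.mem_primeFactorsList (by norm_num)).mpr ⟨hp, hd⟩
      have h3 : Nat.primeFactorsList 249 = [3, 83] := by simp
      rw [h3] at this
      simp only [List.mem_cons, List.not_mem_nil, or_false] at this
      rcases this with rfl | rfl <;> decide +kernel
    rw [← h2]
    have h4 := orderOf_map_dvd
      (ZMod.castHom (dvd_pow_self 499 (Nat.succ_ne_zero n)) (ZMod 499)).toMonoidHom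
      (5 : ZMod (499 ^ (n + 1)))
    have h5 := map_ofNat (ZMod.castHom (dvd_pow_self 499 (Nat.succ_ne_zero n)) (ZMod 499)) 5
    exact h5 ▸ h4
  rw [orderOf_pow_of_dvd (by norm_num) hdvd] at h1
  rw [← h1, Nat.mul_div_cancel' hdvd]

theorem image_five_pow (n : ℕ) :
    (Finset.range (249 * 499 ^ n)).image (fun i => 5 ^ i % 499 ^ (n + 1)) =
      (Finset.range (499 ^ n * 499)).filter (fun x => x ^ 249 % 499 = 1) := by
  apply Finset.eq_of_subset_of_card_le
  · intro x hx
    obtain ⟨i, -, rfl⟩ := Finset.mem_image.mp hx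
    rw [Finset.mem_filter, Finset.mem_range]
    refine ⟨by rw [← pow_succ]; exact Nat.mod_lt _ (by positivity), ?_⟩
    rw [Nat.pow_mod, Nat.mod_mod_of_dvd _ (dvd_pow_self 499 (Nat.succ_ne_zero n)), ← Nat.pow_mod,
      ← pow_mul, mul_comm, pow_mul, Nat.pow_mod]
    norm_num
  · rw [card_squares_range, Finset.card_image_of_injOn, Finset.card_range, mul_comm]
    intro i hi j hj hij
    rw [Finset.coe_range, Set.mem_Iio, ← orderOf_five] at hi hj
    have h : (5 : ZMod (499 ^ (n + 1))) ^ i = 5 ^ j := by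
      have := (ZMod.natCast_eq_natCast_iff _ _ _).mpr hij
      push_cast at this
      exact this
    exact pow_injOn_Iio_orderOf hi hj h

theorem two_mul_sum_five_pow (n : ℕ) :
    2 * ∑ i ∈ Finset.range (249 * 499 ^ n), 5 ^ i % 499 ^ (n + 1) + 3 * 499 ^ (n + 1) =
      499 ^ (n + 1) * (249 * 499 ^ n) := by
  have hinj : Set.InjOn (fun i => 5 ^ i % 499 ^ (n + 1)) (Finset.range (249 * 499 ^ n)) := by
    rw [← Finset.card_image_iff, image_five_pow, card_squares_range, Finset.card_range, mul_comm]
  have h := Finset.sum_image (f := fun x : ℕ => x) hinj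
  rw [image_five_pow, Finset.sum_filter] at h
  rw [← h]
  have := sum_squares_range (499 ^ n)
  rw [pow_succ]
  linarith

theorem exists_five_pow_eq (n x : ℕ) (hx : x ^ 249 % 499 = 1) :
    ∃ i, (x : ZMod (499 ^ (n + 1))) = 5 ^ i := by
  have h : x % 499 ^ (n + 1) ∈
      (Finset.range (499 ^ n * 499)).filter (fun x => x ^ 249 % 499 = 1) := by
    rw [Finset.mem_filter, Finset.mem_range]
    refine ⟨by rw [← pow_succ]; exact Nat.mod_lt _ (by positivity), ?_⟩
    rw [Nat.pow_mod, Nat.mod_mod_of_dvd _ (dvd_pow_self 499 (Nat.succ_ne_zero n)), ← Nat.pow_mod, hx]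
  rw [← image_five_pow] at h
  obtain ⟨i, -, hi⟩ := Finset.mem_image.mp h
  refine ⟨i, ?_⟩
  have := (ZMod.natCast_eq_natCast_iff _ _ _).mpr hi
  push_cast at this
  exact this.symm

theorem exists_multiset_digits (N : ℕ) (r d : ℕ → ℕ) (h : ∀ i, 5 * r i = N * d i + r (i + 1)) (n : ℕ) :
    ∃ s : Multiset ℕ, 5 ^ n * r 0 = N * (s.map (5 ^ ·)).sum + r n ∧
      5 * ∑ i ∈ Finset.range n, r i = N * s.card + ∑ i ∈ Finset.range n, r (i + 1) := by
  induction n with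
  | zero => exact ⟨0, by simp, by simp⟩
  | succ n ih =>
    obtain ⟨s, h1, h2⟩ := ih
    refine ⟨s.map (· + 1) + Multiset.replicate (d n) 0, ?_, ?_⟩
    · have : ((s.map (· + 1)).map (5 ^ ·)).sum = 5 * (s.map (5 ^ ·)).sum := by
        rw [Multiset.map_map, ← Multiset.sum_map_mul_left]
        simp [pow_succ, mul_comm]
      rw [Multiset.map_add, Multiset.sum_add, this]
      simp only [Multiset.map_replicate, pow_zero, Multiset.sum_replicate, smul_eq_mul, mul_one]
      have := h n
      rw [pow_succ]
      linarith
    · rw [Finset.sum_range_succ, Finset.sum_range_succ, Multiset.card_add, Multiset.card_map,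
        Multiset.card_replicate]
      have := h n
      linarith

/-- Base-`5` digits of a fraction `r 0 / N` of `5 ^ n - 1`. -/
theorem exists_multiset_digits_of_periodic (N : ℕ) (r : ℕ → ℕ) (h : ∀ i, 5 * r i ≡ r (i + 1) [MOD N])
    (hlt : ∀ i, r i < N) (n : ℕ) (hn : r n = r 0) :
    ∃ s : Multiset ℕ, (5 ^ n - 1) * r 0 = N * (s.map (5 ^ ·)).sum ∧
      4 * ∑ i ∈ Finset.range n, r i = N * s.card := by
  obtain ⟨s, h1, h2⟩ := exists_multiset_digits N r (fun i => 5 * r i / N) (fun i => by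
    have := h i
    rw [Nat.ModEq, Nat.mod_eq_of_lt (hlt (i + 1))] at this
    rw [← this, Nat.div_add_mod]) n
  refine ⟨s, ?_, ?_⟩
  · rw [Nat.sub_mul, h1, hn, one_mul, Nat.add_sub_cancel]
  · have := Finset.sum_range_succ r n
    rw [Finset.sum_range_succ', hn] at this
    omega

theorem exists_digits_both (n : ℕ) :
    (∃ s : Multiset ℕ, 5 ^ (249 * 499 ^ n) - 1 = 499 ^ (n + 1) * (s.map (5 ^ ·)).sum ∧
      s.card ≤ 2 * (249 * 499 ^ n) + 6) ∧
    ∃ s : Multiset ℕ, (5 ^ (249 * 499 ^ n) - 1) * (499 ^ (n + 1) - 1) =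
      499 ^ (n + 1) * (s.map (5 ^ ·)).sum ∧ s.card ≤ 2 * (249 * 499 ^ n) + 6 := by
  have hsum := two_mul_sum_five_pow n
  have hf : 5 ^ (249 * 499 ^ n) % 499 ^ (n + 1) = 1 := by
    have h := pow_orderOf_eq_one (5 : ZMod (499 ^ (n + 1)))
    rw [orderOf_five] at h
    have h1 : ((5 ^ (249 * 499 ^ n) : ℕ) : ZMod (499 ^ (n + 1))) = (1 : ℕ) := by
      push_cast; exact h
    rw [ZMod.natCast_eq_natCast_iff] at h1
    rw [h1, Nat.mod_eq_of_lt (Nat.one_lt_pow (Nat.succ_ne_zero n) (by norm_num))]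
  have hN : 1 < 499 ^ (n + 1) := Nat.one_lt_pow (Nat.succ_ne_zero n) (by norm_num)
  generalize hNdef : 499 ^ (n + 1) = N at *
  generalize 249 * 499 ^ n = f at *
  have hstep : ∀ i, 5 * (5 ^ i % N) ≡ 5 ^ (i + 1) % N [MOD N] := fun i => by
    rw [pow_succ']
    exact ((Nat.mod_modEq _ _).mul_left 5).trans (Nat.mod_modEq _ _).symm
  have hlt : ∀ i, 5 ^ i % N < N := fun i => Nat.mod_lt _ (by omega)
  have hcop : ∀ i, 0 < 5 ^ i % N := fun i => by
    rw [Nat.pos_iff_ne_zero]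
    intro h0
    have h1 : Nat.Coprime N (5 ^ i) := by
      rw [← hNdef]
      exact Nat.Coprime.pow _ _ (by norm_num)
    have := Nat.Coprime.eq_one_of_dvd h1 (Nat.dvd_of_mod_eq_zero h0)
    omega
  constructor
  · obtain ⟨s, h1, h2⟩ := exists_multiset_digits_of_periodic N (fun i => 5 ^ i % N) hstep hlt f
      (by rw [hf, pow_zero, Nat.mod_eq_of_lt hN])
    rw [pow_zero, Nat.mod_eq_of_lt hN, mul_one] at h1
    refine ⟨s, h1, ?_⟩
    refine Nat.le_of_mul_le_mul_left (c := N) ?_ (by omega)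
    nlinarith
  · obtain ⟨s, h1, h2⟩ := exists_multiset_digits_of_periodic N (fun i => N - 5 ^ i % N) (fun i => by
      have := hstep i
      have e : 5 * (N - 5 ^ i % N) + 5 * (5 ^ i % N) ≡
          (N - 5 ^ (i + 1) % N) + 5 ^ (i + 1) % N [MOD N] := by
        rw [← mul_add, Nat.sub_add_cancel (hlt i).le, Nat.sub_add_cancel (hlt (i + 1)).le,
          Nat.ModEq, Nat.mul_mod_left, Nat.mod_self]
      exact Nat.ModEq.add_right_cancel this e)
      (fun i => Nat.sub_lt (by omega) (hcop i)) f
      (by rw [hf, pow_zero, Nat.mod_eq_of_lt hN])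
    rw [pow_zero, Nat.mod_eq_of_lt hN] at h1
    refine ⟨s, h1, ?_⟩
    have h3 : ∑ i ∈ Finset.range f, (N - 5 ^ i % N) + ∑ i ∈ Finset.range f, 5 ^ i % N = N * f := by
      rw [← Finset.sum_add_distrib, Finset.sum_congr rfl fun i _ => Nat.sub_add_cancel (hlt i).le]
      simp [mul_comm]
    refine Nat.le_of_mul_le_mul_left (c := N) ?_ (by omega)
    nlinarith

end Arithmetic

section GaussSumDivisibility

open IsLocalRing

instance : Fact (Nat.Prime 5) := ⟨by norm_num⟩

theorem exists_isUnit_five_eq {R : Type} [CommRing R] [IsDomain R] [IsLocalRing R] {ζ : R}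
    (hζ : IsPrimitiveRoot ζ 5) (hres : residue R (ζ - 1) = 0) :
    ∃ u : R, IsUnit u ∧ (ζ - 1) ^ 4 = 5 * u := by
  refine ⟨-(1 + (ζ - 1) * (2 + 2 * (ζ - 1) + (ζ - 1) ^ 2)), ?_, ?_⟩
  · rw [← residue_ne_zero_iff_isUnit, map_neg, map_add, map_mul, hres, map_one]
    simp
  · have h := hζ.geom_sum_eq_zero (by norm_num)
    simp only [Finset.sum_range_succ, Finset.sum_range_zero] at h
    linear_combination h

theorem pow_dvd_of_mul_eq {R : Type} [CommRing R] [IsDomain R] {π u a b : R} (hπ : π ≠ 0)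
    (hu : IsUnit u) (h4 : π ^ 4 = 5 * u) {f e : ℕ} (hfe : f = 2 * e + 3) (hab : a * b = 5 ^ f)
    (hb : b ∣ π ^ (2 * f + 6)) : 5 ^ e ∣ a := by
  obtain ⟨c, hc⟩ := hb
  have h2 : a * π ^ (2 * f + 6) * u ^ f = π ^ (4 * f) * c := by
    rw [pow_mul π 4, h4, mul_pow, ← hab, hc]; ring
  have h3 : π ^ (2 * f + 6) * (a * u ^ f) = π ^ (2 * f + 6) * (π ^ (4 * e) * c) := by
    rw [show π ^ (2 * f + 6) * (π ^ (4 * e) * c) = π ^ (4 * f) * c by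
      rw [← mul_assoc, ← pow_add]; congr 2; omega, ← h2]
    ring
  have h5 := mul_left_cancel₀ (pow_ne_zero _ hπ) h3
  rw [pow_mul, h4, mul_pow] at h5
  exact ((hu.pow f).dvd_mul_right).mp ⟨u ^ e * c, by rw [h5, mul_assoc]⟩

theorem gaussSum_mul_gaussSum_inv_of_odd {F R : Type} [Field F] [Fintype F] [CommRing R]
    [IsDomain R] {χ : MulChar F R} (hχ : χ ≠ 1) {N : ℕ} (hN : Odd N) (hχN : χ ^ N = 1)
    {ψ : AddChar F R} (hψ : ψ.IsPrimitive) :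
    gaussSum χ ψ * gaussSum χ⁻¹ ψ = Fintype.card F := by
  rw [← gaussSum_mul_gaussSum_eq_card hχ hψ, AddChar.inv_mulShift,
    ← gaussSum_mulShift χ⁻¹ ψ (-1)]
  have h1 : χ⁻¹ ((-1 : Fˣ) : F) = 1 := by
    have h2 : χ⁻¹ ((-1 : Fˣ) : F) ^ N = 1 := by
      rw [← MulChar.pow_apply_coe, inv_pow, hχN, inv_one, MulChar.one_apply_coe]
    obtain ⟨k, rfl⟩ := hN
    rw [pow_succ, pow_mul, ← map_pow] at h2
    simpa using h2
  rw [h1, one_mul]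
  simp

/-- For the characters of order `499 ^ (n + 1)`, the Gauss sums are divisible by the power of `5`
predicted by Stickelberger's theorem. -/
theorem exists_char_gaussSum_dvd (n f N e : ℕ) (hf : f = 249 * 499 ^ n) (hN : N = 499 ^ (n + 1))
    (he : f = 2 * e + 3) (F : Type) [Field F] [Fintype F] [Algebra (ZMod 5) F]
    (hF : Fintype.card F = 5 ^ f) (γ : Fˣ) (hγ : orderOf γ = 5 ^ f - 1) :
    ∃ (R : Type) (_ : CommRing R) (_ : IsDomain R) (_ : CharZero R) (ζ : R)
      (hζ : IsPrimitiveRoot ζ 5) (χ : MulChar F R),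
      ¬ IsUnit (5 : R) ∧ IsPrimitiveRoot (χ γ) N ∧
      5 ^ e ∣ gaussSum χ (traceChar F hζ.pow_eq_one) ∧
      5 ^ e ∣ gaussSum χ⁻¹ (traceChar F hζ.pow_eq_one) ∧
      gaussSum χ (traceChar F hζ.pow_eq_one) * gaussSum χ⁻¹ (traceChar F hζ.pow_eq_one) =
        5 ^ f := by
  have : CharP F 5 := charP_of_injective_algebraMap (algebraMap (ZMod 5) F).injective 5
  obtain ⟨R, _, _, _, _, ζ, ω, ι, hζ, h0, hι⟩ := exists_teichmuller_lift 5 F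
  have hres := residue_sub_one ι hζ.pow_eq_one
  obtain ⟨u, hu, h4⟩ := exists_isUnit_five_eq hζ hres
  obtain ⟨⟨s₁, hs₁, hc₁⟩, s₂, hs₂, hc₂⟩ := exists_digits_both n
  rw [← hf, ← hN] at hs₁ hs₂
  rw [← hf] at hc₁ hc₂
  have hN1 : 1 < N := hN ▸ Nat.one_lt_pow (Nat.succ_ne_zero n) (by norm_num)
  have hf0 : f ≠ 0 := by omega
  have hq : 1 < 5 ^ f := Nat.one_lt_pow hf0 (by norm_num)
  set c := (s₁.map (5 ^ ·)).sum with hc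
  have hc0 : 0 < c := by
    rw [Nat.pos_iff_ne_zero]; intro h; rw [h] at hs₁; omega
  have hs₂' : (s₂.map (5 ^ ·)).sum = c * (N - 1) := by
    rw [hs₁, mul_assoc] at hs₂
    exact (Nat.eq_of_mul_eq_mul_left (by omega) hs₂).symm
  have hs₁0 : s₁ ≠ 0 := by rintro rfl; simp at hc; omega
  have hs₂0 : s₂ ≠ 0 := by
    rintro rfl
    have : 0 < c * (N - 1) := Nat.mul_pos hc0 (by omega)
    simp at hs₂'; omega
  have hlt : c < orderOf γ := by
    rw [hγ, hs₁]
    nlinarith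
  have hlt₂ : c * (N - 1) < orderOf γ := by
    rw [hγ, hs₁, mul_comm N c]
    exact Nat.mul_lt_mul_of_pos_left (by omega) hc0
  have hχN : (invChar ω h0 ^ c) ^ N = 1 := by
    rw [← pow_mul, mul_comm, ← hs₁, ← hF, ← Fintype.card_units]
    exact MulChar.pow_card_eq_one _
  have hχ1 : invChar ω h0 ^ c ≠ 1 := invChar_pow_ne_one ω h0 ι hι γ hc0 hlt
  have hinv : (invChar ω h0 ^ c)⁻¹ = invChar ω h0 ^ (c * (N - 1)) := by
    rw [inv_eq_iff_mul_eq_one, pow_mul, ← pow_succ', Nat.sub_add_cancel hN1.le, hχN]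
  have hprod := gaussSum_mul_gaussSum_inv_of_odd hχ1 (hN ▸ Odd.pow (by decide)) hχN
    (traceChar_isPrimitive (F := F) hζ)
  rw [hF, Nat.cast_pow, Nat.cast_ofNat] at hprod
  have hd₁ := gaussSum_invChar_pow_dvd ω h0 ι hι hζ.pow_eq_one γ s₁ hs₁0 hlt
  have hd₂ := gaussSum_invChar_pow_dvd ω h0 ι hι hζ.pow_eq_one γ s₂ hs₂0 (hs₂' ▸ hlt₂)
  rw [hs₂', ← hinv] at hd₂
  have hπ : ζ - 1 ≠ 0 := sub_ne_zero.mpr (hζ.ne_one (by norm_num))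
  refine ⟨R, inferInstance, inferInstance, inferInstance, ζ, hζ, invChar ω h0 ^ c, ?_, ?_,
    ?_, ?_, hprod⟩
  · rw [← residue_ne_zero_iff_isUnit, not_not]
    have h := congrArg (residue R) h4
    rw [map_pow, hres, zero_pow (by norm_num), map_mul] at h
    exact (mul_eq_zero.mp h.symm).resolve_right ((residue_ne_zero_iff_isUnit _).mpr hu)
  · refine ⟨?_, fun l hl => ?_⟩
    · rw [← MulChar.pow_apply_coe, hχN, MulChar.one_apply_coe]
    · rw [← MulChar.pow_apply_coe, ← pow_mul, MulChar.pow_apply_coe, invChar_apply] at hl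
      have h2 := congrArg (residue R) hl
      rw [map_pow, hι, map_one, ← map_pow, map_eq_one_iff _ ι.injective, inv_pow, inv_eq_one] at h2
      have h3 : γ ^ (c * l) = 1 := Units.ext (by simpa using h2)
      have h5 := orderOf_dvd_of_pow_eq_one h3
      rw [hγ, hs₁, mul_comm N c] at h5
      exact Nat.dvd_of_mul_dvd_mul_left hc0 h5
  · exact pow_dvd_of_mul_eq hπ hu h4 he hprod (hd₂.trans (pow_dvd_pow _ hc₂))
  · exact pow_dvd_of_mul_eq hπ hu h4 he (by rw [mul_comm]; exact hprod)
      (hd₁.trans (pow_dvd_pow _ hc₁))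

theorem int_dvd_of_cast_dvd {R : Type} [CommRing R] [IsDomain R] [CharZero R]
    (h5 : ¬ IsUnit (5 : R)) (e : ℕ) (a : ℤ) (h : (5 : R) ^ e ∣ a) : (5 : ℤ) ^ e ∣ a := by
  induction e generalizing a with
  | zero => simp
  | succ e ih =>
    have h1 : (5 : ℤ) ∣ a := by
      by_contra h2
      have h3 : IsCoprime (5 : ℤ) a := (Int.prime_iff_natAbs_prime.mpr (by norm_num)).coprime_iff_not_dvd.mpr h2
      have h4 : IsCoprime (5 : R) (a : R) := by simpa using h3.map (Int.castRingHom R)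
      exact h5 (h4.isUnit_of_dvd ((dvd_pow_self _ (Nat.succ_ne_zero e)).trans h))
    obtain ⟨b, rfl⟩ := h1
    rw [pow_succ']
    refine mul_dvd_mul_left _ (ih b ?_)
    rw [pow_succ', Int.cast_mul, Int.cast_ofNat] at h
    exact (mul_dvd_mul_iff_left (by norm_num)).mp h

end GaussSumDivisibility

section ClassSums

/-- The discrete logarithm to the base `γ`, modulo `N`. -/
theorem exists_log_mod {G : Type} [CommGroup G] {N : ℕ} (γ : G) (hN : N ∣ orderOf γ)
    (hγ : ∀ x : G, ∃ k : ℕ, x = γ ^ k) :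
    ∃ ℓ : G → ZMod N, (∀ x y, ℓ (x * y) = ℓ x + ℓ y) ∧ ∀ k : ℕ, ℓ (γ ^ k) = k := by
  choose ℓ hℓ using hγ
  have hpow : ∀ k : ℕ, (ℓ (γ ^ k) : ZMod N) = k := fun k => by
    rw [ZMod.natCast_eq_natCast_iff]
    exact (pow_eq_pow_iff_modEq.mp (hℓ (γ ^ k)).symm).of_dvd hN
  refine ⟨fun x => ℓ x, fun x y => ?_, hpow⟩
  have h := hpow (ℓ x + ℓ y)
  rwa [pow_add, ← hℓ, ← hℓ, Nat.cast_add] at h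

variable {F : Type} [Field F] [Algebra (ZMod 5) F] {R : Type} [CommRing R] [IsDomain R] {ζ : R}

theorem sum_traceChar_mul (hζ : IsPrimitiveRoot ζ 5) (x : F) :
    ∑ t ∈ Finset.range 4, traceChar F hζ.pow_eq_one ((t + 1 : ℕ) * x) =
      ((if Algebra.trace (ZMod 5) F x = 0 then 4 else -1 : ℤ) : R) := by
  have h : ∀ n : ℕ, traceChar F hζ.pow_eq_one (n * x) = traceChar F hζ.pow_eq_one x ^ n := fun n => by
    rw [← nsmul_eq_mul, AddChar.map_nsmul_eq_pow]
  simp_rw [h, traceChar_apply]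
  split_ifs with h0
  · simp [h0]
  · have h1 : (Algebra.trace (ZMod 5) F x).val.Coprime 5 := by
      refine Nat.Coprime.symm ((Nat.Prime.coprime_iff_not_dvd (by norm_num)).mpr fun hd => h0 ?_)
      have := Nat.eq_zero_of_dvd_of_lt hd (ZMod.val_lt _)
      simpa using this
    have h2 := (hζ.pow_of_coprime _ h1).geom_sum_eq_zero (by norm_num)
    simp only [Finset.sum_range_succ, Finset.sum_range_zero] at h2 ⊢
    push_cast
    linear_combination h2

variable [Fintype F] {N : ℕ}

/-- The sum over the class `ℓ x = a` of `4` times the trace character at `x`. -/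
def classSum (ℓ : Fˣ → ZMod N) (a : ZMod N) : ℤ :=
  ∑ x : Fˣ, if ℓ x = a then (if Algebra.trace (ZMod 5) F x = 0 then 4 else -1) else 0

theorem classSum_five_mul (hN : IsUnit (5 : ZMod N)) {ℓ : Fˣ → ZMod N}
    (hℓ : ∀ x y, ℓ (x * y) = ℓ x + ℓ y) (a : ZMod N) :
    classSum ℓ (5 * a) = classSum ℓ a := by
  have hinj : Function.Injective (fun x : Fˣ => x ^ 5) := fun x y hxy => Units.ext
    ((frobenius_bijective_of_finite (p := 5) (F := F)).1 (by simpa using congrArg Units.val hxy))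
  unfold classSum
  rw [← (Finite.injective_iff_bijective.mp hinj).sum_comp]
  refine Finset.sum_congr rfl fun x _ => ?_
  have h : ℓ (x ^ 5) = 5 * ℓ x := by
    rw [pow_succ, pow_succ, pow_succ, pow_two, hℓ, hℓ, hℓ, hℓ]; ring
  simp only [h, hN.mul_right_inj, Units.val_pow_eq_pow_val, trace_pow_char]

theorem classSum_five_pow_mul (hN : IsUnit (5 : ZMod N)) {ℓ : Fˣ → ZMod N}
    (hℓ : ∀ x y, ℓ (x * y) = ℓ x + ℓ y) (i : ℕ) (a : ZMod N) :
    classSum ℓ (5 ^ i * a) = classSum ℓ a := by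
  induction i with
  | zero => simp
  | succ i ih => rw [pow_succ', mul_assoc, classSum_five_mul hN hℓ, ih]

theorem four_mul_sum_class (hζ : IsPrimitiveRoot ζ 5) (hN : IsUnit (4 : ZMod N)) {ℓ : Fˣ → ZMod N}
    (hℓ : ∀ x y, ℓ (x * y) = ℓ x + ℓ y) (a : ZMod N) :
    4 * ∑ x : Fˣ, (if ℓ x = a then traceChar F hζ.pow_eq_one x else 0) = (classSum ℓ a : R) := by
  have hCharP : CharP F 5 := charP_of_injective_algebraMap (algebraMap (ZMod 5) F).injective 5
  have hone : ℓ 1 = 0 := by simpa using hℓ 1 1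
  have h : ∀ t ∈ Finset.range 4,
      ∑ x : Fˣ, (if ℓ x = a then traceChar F hζ.pow_eq_one ((t + 1 : ℕ) * x) else 0) =
        ∑ x : Fˣ, (if ℓ x = a then traceChar F hζ.pow_eq_one x else 0) := by
    intro t ht
    have ht0 : ((t + 1 : ℕ) : F) ≠ 0 := by
      rw [Ne, CharP.cast_eq_zero_iff F 5]
      rw [Finset.mem_range] at ht
      omega
    obtain ⟨u, hu⟩ := ht0.isUnit
    have hu4 : u ^ 4 = 1 := by
      have h1 : ((t + 1 : ℕ) : ZMod 5) ^ 4 = 1 := by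
        refine ZMod.pow_card_sub_one_eq_one (p := 5) fun h => ht0 ?_
        simpa using congrArg (algebraMap (ZMod 5) F) h
      refine Units.ext ?_
      rw [Units.val_pow_eq_pow_val, hu]
      simpa using congrArg (algebraMap (ZMod 5) F) h1
    have hlu : ℓ u = 0 := by
      have h2 : 4 * ℓ u = 4 * 0 := by
        rw [mul_zero, ← hone, ← hu4, pow_succ, pow_succ, pow_two, hℓ, hℓ, hℓ]; ring
      exact hN.mul_left_cancel h2
    rw [← (Group.mulLeft_bijective u).sum_comp
      (fun x : Fˣ => if ℓ x = a then traceChar F hζ.pow_eq_one (x : F) else 0)]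
    refine Finset.sum_congr rfl fun x _ => ?_
    rw [hℓ, hlu, zero_add, Units.val_mul, hu]
  have h4 : (4 : R) * ∑ x : Fˣ, (if ℓ x = a then traceChar F hζ.pow_eq_one x else 0) =
      ∑ t ∈ Finset.range 4, ∑ x : Fˣ, (if ℓ x = a then traceChar F hζ.pow_eq_one x else 0) := by
    simp
  rw [h4, ← Finset.sum_congr rfl h, Finset.sum_comm, classSum, Int.cast_sum]
  refine Finset.sum_congr rfl fun x _ => ?_
  by_cases hx : ℓ x = a
  · simp only [if_pos hx]
    exact sum_traceChar_mul hζ _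
  · simp [hx]

theorem four_mul_sum_class_mul (hζ : IsPrimitiveRoot ζ 5) (hN : IsUnit (4 : ZMod N))
    {ℓ : Fˣ → ZMod N} (hℓ : ∀ x y, ℓ (x * y) = ℓ x + ℓ y) (a : ZMod N) (b : Fˣ) :
    4 * ∑ x : Fˣ, (if ℓ x = a then traceChar F hζ.pow_eq_one (b * x) else 0) =
      (classSum ℓ (ℓ b + a) : R) := by
  rw [← four_mul_sum_class hζ hN hℓ, ← (Group.mulLeft_bijective b).sum_comp
    (fun x : Fˣ => if ℓ x = ℓ b + a then traceChar F hζ.pow_eq_one (x : F) else 0)]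
  simp only [hℓ, add_right_inj, Units.val_mul]

theorem sum_range_ite_natCast_eq [NeZero N] {α : Type} [AddCommMonoid α] (a : ZMod N) (c : ℕ → α) :
    ∑ i ∈ Finset.range N, (if a = i then c i else 0) = c a.val := by
  rw [Finset.sum_eq_single a.val]
  · simp
  · intro i hi hia
    rw [if_neg]
    rintro rfl
    exact hia (ZMod.val_cast_of_lt (Finset.mem_range.mp hi)).symm
  · intro h
    exact absurd (Finset.mem_range.mpr (ZMod.val_lt a)) h

theorem four_mul_gaussSum_eq [NeZero N] (hζ : IsPrimitiveRoot ζ 5) (hN : IsUnit (4 : ZMod N))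
    {ℓ : Fˣ → ZMod N} (hℓ : ∀ x y, ℓ (x * y) = ℓ x + ℓ y) {γ : Fˣ}
    (hγ : ∀ k : ℕ, ℓ (γ ^ k) = k) (hgen : ∀ x : Fˣ, ∃ k : ℕ, x = γ ^ k) (χ : MulChar F R)
    (hχ : χ γ ^ N = 1) :
    4 * gaussSum χ (traceChar F hζ.pow_eq_one) =
      ∑ i ∈ Finset.range N, χ γ ^ i * (classSum ℓ i : R) := by
  have h : gaussSum χ (traceChar F hζ.pow_eq_one) =
      ∑ x : Fˣ, χ γ ^ (ℓ x).val * traceChar F hζ.pow_eq_one (x : F) := by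
    unfold gaussSum
    rw [← Finset.sum_subset (Finset.subset_univ (Finset.univ.image (Units.val : Fˣ → F))),
      Finset.sum_image (fun x _ y _ hxy => Units.ext hxy)]
    · refine Finset.sum_congr rfl fun x _ => ?_
      obtain ⟨k, rfl⟩ := hgen x
      rw [hγ, ZMod.val_natCast, ← pow_eq_pow_mod k hχ, Units.val_pow_eq_pow_val, map_pow]
    · intro x _ hx
      rw [MulChar.map_nonunit, zero_mul]
      rintro ⟨u, rfl⟩
      exact hx (Finset.mem_image_of_mem _ (Finset.mem_univ u))
  simp_rw [← four_mul_sum_class hζ hN hℓ, mul_left_comm _ (4 : R), ← Finset.mul_sum, h]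
  congr 1
  simp_rw [Finset.mul_sum]
  rw [Finset.sum_comm]
  refine Finset.sum_congr rfl fun x _ => ?_
  rw [← sum_range_ite_natCast_eq (ℓ x) (fun i => χ γ ^ i * traceChar F hζ.pow_eq_one (x : F))]
  refine Finset.sum_congr rfl fun i _ => ?_
  rw [mul_ite, mul_zero]

end ClassSums

section QuadraticEvaluation

theorem invariant_add_period {n : ℕ} {h : ZMod (499 ^ (n + 1)) → ℤ}
    (hinv : ∀ (i : ℕ) a, h (5 ^ i * a) = h a) {a : ℕ} (ha : ¬ 499 ^ n ∣ a) :
    h ((a + 499 ^ n : ℕ)) = h a := by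
  have ha0 : a ≠ 0 := by rintro rfl; exact ha (dvd_zero _)
  obtain ⟨t, b, hb, rfl⟩ := Nat.exists_eq_pow_mul_and_not_dvd ha0 499 (by norm_num)
  have ht : t < n := by
    by_contra hnt
    exact ha ((pow_dvd_pow _ (not_lt.mp hnt)).mul_right _)
  obtain ⟨s, rfl⟩ := Nat.exists_eq_add_of_lt ht
  obtain ⟨c, -, hc⟩ := Nat.exists_mul_mod_eq_one_of_coprime
    ((Nat.Prime.coprime_iff_not_dvd (by norm_num)).mpr hb).symm (by norm_num : 1 < 499)
  obtain ⟨i, hi⟩ := exists_five_pow_eq (t + s + 1) (1 + 499 * (499 ^ s * c)) (by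
    rw [Nat.pow_mod, Nat.add_mul_mod_self_left])
  rw [← hinv i ((499 ^ t * b : ℕ) : ZMod _), ← hi, ← Nat.cast_mul]
  congr 1
  rw [ZMod.natCast_eq_natCast_iff]
  have h1 : 499 ^ (t + s + 1) * 1 ≡ 499 ^ (t + s + 1) * (b * c) [MOD 499 ^ (t + s + 1 + 1)] := by
    rw [pow_succ _ (t + s + 1)]
    refine Nat.ModEq.mul_left' _ ?_
    rw [Nat.ModEq, hc]
  rw [mul_one] at h1
  refine (h1.add_left (499 ^ t * b)).trans ?_
  rw [Nat.ModEq]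
  congr 1
  ring

theorem sum_range_pow_mul_invariant {n N : ℕ} (hN : N = 499 ^ (n + 1)) {R : Type} [CommRing R]
    [IsDomain R] {θ : R} (hθ : IsPrimitiveRoot θ N) {h : ZMod N → ℤ}
    (hinv : ∀ (i : ℕ) a, h (5 ^ i * a) = h a) :
    ∑ i ∈ Finset.range N, θ ^ i * (h i : R) =
      ∑ c ∈ Finset.range 499, (θ ^ 499 ^ n) ^ c * (h ((499 ^ n * c : ℕ)) : R) := by
  subst hN
  have hz : IsPrimitiveRoot (θ ^ 499 ^ n) 499 := hθ.pow (by positivity) (pow_succ _ _)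
  have hsplit := sum_range_mul_eq (fun i => θ ^ i * (h i : R)) 499 (499 ^ n)
  rw [← pow_succ'] at hsplit
  rw [hsplit, Finset.sum_comm, Finset.sum_eq_single 0]
  · simp_rw [add_zero, pow_mul]
  · intro j hj hj0
    have hc : ∀ c : ℕ, h ((499 ^ n * c + j : ℕ)) = h j := fun c => by
      induction c with
      | zero => simp
      | succ c ih =>
        rw [← ih, ← invariant_add_period hinv (a := 499 ^ n * c + j)]
        · congr 2; ring
        · rw [Nat.dvd_add_right (dvd_mul_right _ _)]
          exact Nat.not_dvd_of_pos_of_lt (Nat.pos_of_ne_zero hj0) (Finset.mem_range.mp hj)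
    simp_rw [hc, pow_add, pow_mul, mul_assoc, ← Finset.sum_mul]
    rw [hz.geom_sum_eq_zero (by norm_num), zero_mul]
  · intro h0
    exact absurd (Finset.mem_range.mpr (by positivity)) h0

theorem quadraticChar_natCast_of_pow {c : ℕ} (hc : c ^ 249 % 499 = 1) :
    quadraticChar (ZMod 499) c = 1 := by
  have hc1 : (c : ZMod 499) ^ 249 = 1 := by
    have := (ZMod.natCast_eq_natCast_iff (c ^ 249) 1 499).mpr hc
    simpa using this
  have hc0 : (c : ZMod 499) ≠ 0 := by
    intro h0
    rw [h0, zero_pow (by norm_num)] at hc1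
    exact zero_ne_one hc1
  rw [quadraticChar_one_iff_isSquare hc0, ZMod.euler_criterion _ hc0]
  exact hc1

theorem quadraticChar_neg_one_499 : quadraticChar (ZMod 499) (-1) = -1 := by
  rw [quadraticChar_neg_one (by rw [ZMod.ringChar_zmod_n]; norm_num), ZMod.card]
  decide

theorem two_mul_invariant {n N : ℕ} (hN : N = 499 ^ (n + 1)) {h : ZMod N → ℤ}
    (hinv : ∀ (i : ℕ) a, h (5 ^ i * a) = h a) {c : ℕ} (hc : c < 499) :
    2 * h ((499 ^ n * c : ℕ)) =
      (if (c : ZMod 499) = 0 then 2 * h 0 - h (499 ^ n) - h (-499 ^ n) else 0) +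
        (h (499 ^ n) + h (-499 ^ n)) +
        quadraticChar (ZMod 499) c * (h (499 ^ n) - h (-499 ^ n)) := by
  subst hN
  have hne : ∀ {a : ℤ}, (quadraticChar (ZMod 499) c = a) → a ≠ 0 → (c : ZMod 499) ≠ 0 := by
    rintro a ha ha0 h0
    rw [h0, MulChar.map_zero] at ha
    exact ha0 ha.symm
  rcases mod_eq_zero_or_square_or_neg_square c hc with rfl | hc1 | hc1
  · simp
  · have h1 := quadraticChar_natCast_of_pow hc1
    obtain ⟨i, hi⟩ := exists_five_pow_eq n c hc1
    rw [if_neg (hne h1 one_ne_zero), h1, Nat.cast_mul, hi, Nat.cast_comm (499 ^ n), hinv]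
    push_cast
    ring
  · have h1 := quadraticChar_natCast_of_pow hc1
    rw [Nat.cast_sub hc.le, CharP.cast_eq_zero, zero_sub, neg_eq_neg_one_mul, map_mul,
      quadraticChar_neg_one_499, neg_one_mul, neg_eq_iff_eq_neg] at h1
    obtain ⟨i, hi⟩ := exists_five_pow_eq n _ hc1
    have h2 : ((499 ^ n * c : ℕ) : ZMod (499 ^ (n + 1))) = 5 ^ i * (-499 ^ n) := by
      have h3 : ((499 ^ (n + 1) : ℕ) : ZMod (499 ^ (n + 1))) = 0 := CharP.cast_eq_zero _ _
      rw [← hi, Nat.cast_sub hc.le]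
      push_cast at h3 ⊢
      linear_combination h3
    rw [if_neg (hne h1 (by norm_num)), h1, h2, hinv]
    ring

theorem sum_range_natCast_eq_sum_zmod {N : ℕ} [NeZero N] {α : Type} [AddCommMonoid α] (c : ZMod N → α) :
    ∑ i ∈ Finset.range N, c i = ∑ a : ZMod N, c a :=
  Finset.sum_nbij' (fun i => (i : ZMod N)) ZMod.val (fun _ _ => Finset.mem_univ _)
    (fun a _ => Finset.mem_range.mpr (ZMod.val_lt a))
    (fun _ hi => ZMod.val_cast_of_lt (Finset.mem_range.mp hi)) (fun a _ => by simp) (fun _ _ => rfl)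

theorem two_mul_sum_invariant {n N : ℕ} (hN : N = 499 ^ (n + 1)) {R : Type} [CommRing R]
    [IsDomain R] {θ : R} (hθ : IsPrimitiveRoot θ N) {h : ZMod N → ℤ}
    (hinv : ∀ (i : ℕ) a, h (5 ^ i * a) = h a) (hz : IsPrimitiveRoot (θ ^ 499 ^ n) 499) :
    2 * ∑ i ∈ Finset.range N, θ ^ i * (h i : R) =
      ((2 * h 0 - h (499 ^ n) - h (-499 ^ n) : ℤ) : R) + ((h (499 ^ n) - h (-499 ^ n) : ℤ) : R) *
        gaussSum ((quadraticChar (ZMod 499)).ringHomComp (Int.castRingHom R))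
          (AddChar.zmodChar 499 hz.pow_eq_one) := by
  rw [sum_range_pow_mul_invariant hN hθ hinv, Finset.mul_sum]
  have hsum := hz.geom_sum_eq_zero (by norm_num)
  have h1 : ∀ c ∈ Finset.range 499, 2 * ((θ ^ 499 ^ n) ^ c * (h ((499 ^ n * c : ℕ)) : R)) =
      (if (c : ZMod 499) = 0 then ((2 * h 0 - h (499 ^ n) - h (-499 ^ n) : ℤ) : R) else 0) +
      (θ ^ 499 ^ n) ^ c * ((h (499 ^ n) + h (-499 ^ n) : ℤ) : R) +
      ((h (499 ^ n) - h (-499 ^ n) : ℤ) : R) *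
        ((quadraticChar (ZMod 499)).ringHomComp (Int.castRingHom R) (c : ZMod 499) *
          AddChar.zmodChar 499 hz.pow_eq_one (c : ZMod 499)) := by
    intro c hc
    have h2 := congrArg (Int.cast : ℤ → R) (two_mul_invariant hN hinv (Finset.mem_range.mp hc))
    rw [AddChar.zmodChar_apply', MulChar.ringHomComp_apply, eq_intCast]
    by_cases hc0 : c = 0
    · subst hc0
      simp only [Nat.cast_zero, if_true, pow_zero] at h2 ⊢
      push_cast at h2 ⊢
      linear_combination h2
    · have hc0' : (c : ZMod 499) ≠ 0 := by
        rw [Ne, CharP.cast_eq_zero_iff (ZMod 499) 499]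
        exact Nat.not_dvd_of_pos_of_lt (Nat.pos_of_ne_zero hc0) (Finset.mem_range.mp hc)
      rw [if_neg hc0'] at h2 ⊢
      push_cast at h2 ⊢
      linear_combination (θ ^ 499 ^ n) ^ c * h2
  rw [Finset.sum_congr rfl h1, Finset.sum_add_distrib, Finset.sum_add_distrib, ← Finset.sum_mul, hsum,
    zero_mul, add_zero, ← Finset.mul_sum,
    sum_range_natCast_eq_sum_zmod (fun a : ZMod 499 => if a = 0 then _ else (0 : R)),
    Finset.sum_ite_eq' Finset.univ (0 : ZMod 499), if_pos (Finset.mem_univ _),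
    sum_range_natCast_eq_sum_zmod (fun a : ZMod 499 =>
      (quadraticChar (ZMod 499)).ringHomComp (Int.castRingHom R) a *
        AddChar.zmodChar 499 hz.pow_eq_one a)]
  rfl

theorem eq_or_eq_neg_of_sq_add_eq {A B : ℤ} {e f : ℕ} (he : f = 2 * e + 3)
    (hA : (5 : ℤ) ^ e ∣ A) (hB : (5 : ℤ) ^ e ∣ B) (h : A ^ 2 + 499 * B ^ 2 = 64 * 5 ^ f) :
    A = B ∨ A = -B := by
  obtain ⟨a, rfl⟩ := hA
  obtain ⟨b, rfl⟩ := hB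
  have h1 : a ^ 2 + 499 * b ^ 2 = 8000 := by
    have h5 : ((5 : ℤ) ^ e) ^ 2 ≠ 0 := by positivity
    apply mul_left_cancel₀ h5
    rw [he, pow_add, pow_mul'] at h
    linear_combination h
  have h2 : a.natAbs ^ 2 + 499 * b.natAbs ^ 2 = 8000 := by
    zify
    rwa [sq_abs, sq_abs]
  have hab : ∀ x < 90, ∀ y < 5, x ^ 2 + 499 * y ^ 2 = 8000 → x = y := by decide +kernel
  have h3 := hab a.natAbs (by nlinarith) b.natAbs (by nlinarith) h2
  rcases Int.natAbs_eq_natAbs_iff.mp h3 with rfl | rfl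
  · exact Or.inl rfl
  · exact Or.inr (by ring)

end QuadraticEvaluation

section TwoValues

theorem classSum_zero_eq_or {n f N e : ℕ} (hf : f = 249 * 499 ^ n) (hN : N = 499 ^ (n + 1))
    (he : f = 2 * e + 3) {F : Type} [Field F] [Fintype F] [Algebra (ZMod 5) F]
    (hF : Fintype.card F = 5 ^ f) {γ : Fˣ} (hγ : orderOf γ = 5 ^ f - 1) {ℓ : Fˣ → ZMod N}
    (hℓ : ∀ x y, ℓ (x * y) = ℓ x + ℓ y) (hpow : ∀ k : ℕ, ℓ (γ ^ k) = k)
    (hgen : ∀ x : Fˣ, ∃ k : ℕ, x = γ ^ k) (h5 : IsUnit (5 : ZMod N)) (h4 : IsUnit (4 : ZMod N)) :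
    classSum ℓ 0 = classSum ℓ (499 ^ n) ∨ classSum ℓ 0 = classSum ℓ (-499 ^ n) := by
  obtain ⟨R, _, _, _, ζ, hζ, χ, h5R, hχ, hd, hd', hprod⟩ :=
    exists_char_gaussSum_dvd n f N e hf hN he F hF γ hγ
  have : NeZero N := ⟨by rw [hN]; positivity⟩
  have hinv := classSum_five_pow_mul h5 hℓ
  have hmul : χ γ * χ⁻¹ γ = 1 := by
    rw [← MulChar.mul_apply, mul_inv_cancel, MulChar.one_apply_coe]
  have hmul_pow : ∀ l : ℕ, χ γ ^ l * χ⁻¹ γ ^ l = 1 := fun l => by rw [← mul_pow, hmul, one_pow]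
  have hχ' : IsPrimitiveRoot (χ⁻¹ γ) N := by
    refine ⟨?_, fun l hl => hχ.dvd_of_pow_eq_one l ?_⟩
    · have h := hmul_pow N
      rwa [hχ.pow_eq_one, one_mul] at h
    · have h := hmul_pow l
      rwa [hl, mul_one] at h
  have hz := hχ.pow (by rw [hN]; positivity) (show N = 499 ^ n * 499 by rw [hN, pow_succ])
  have hz' := hχ'.pow (by rw [hN]; positivity) (show N = 499 ^ n * 499 by rw [hN, pow_succ])
  have hg := two_mul_sum_invariant hN hχ hinv hz
  have hg' := two_mul_sum_invariant hN hχ' hinv hz'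
  rw [← four_mul_gaussSum_eq hζ h4 hℓ hpow hgen χ hχ.pow_eq_one] at hg
  rw [← four_mul_gaussSum_eq hζ h4 hℓ hpow hgen χ⁻¹ hχ'.pow_eq_one] at hg'
  set η := (quadraticChar (ZMod 499)).ringHomComp (Int.castRingHom R) with hη
  have hη1 : η (-1) = -1 := by
    rw [hη, MulChar.ringHomComp_apply, quadraticChar_neg_one_499]; simp
  have hchar : AddChar.zmodChar 499 hz'.pow_eq_one =
      (AddChar.zmodChar 499 hz.pow_eq_one).mulShift (-1) := by
    ext a
    have ha : (AddChar.zmodChar 499 hz.pow_eq_one) a * (AddChar.zmodChar 499 hz'.pow_eq_one) a =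
        1 := by
      rw [AddChar.zmodChar_apply, AddChar.zmodChar_apply, ← mul_pow, hmul_pow, one_pow]
    refine mul_left_cancel₀ (left_ne_zero_of_mul_eq_one ha) (ha.trans ?_)
    rw [AddChar.mulShift_apply, ← AddChar.map_add_eq_mul, neg_one_mul, add_neg_cancel,
      AddChar.map_zero_eq_one]
  have hneg := gaussSum_mulShift η (AddChar.zmodChar 499 hz.pow_eq_one) (-1)
  rw [← Units.coe_neg_one] at hη1 hchar
  rw [hη1, ← hchar] at hneg
  have hη2 : η.IsQuadratic := (quadraticChar_isQuadratic (ZMod 499)).comp _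
  have hη0 : η ≠ 1 := by
    intro h
    rw [h, MulChar.one_apply_coe] at hη1
    norm_num at hη1
  have hsq := gaussSum_sq hη0 hη2 (AddChar.zmodChar_primitive_of_primitive_root 499 hz)
  rw [← Units.coe_neg_one, hη1, ZMod.card] at hsq
  set δ := gaussSum η (AddChar.zmodChar 499 hz.pow_eq_one) with hδ
  set A := 2 * classSum ℓ 0 - classSum ℓ (499 ^ n) - classSum ℓ (-499 ^ n) with hA
  set B := classSum ℓ (499 ^ n) - classSum ℓ (-499 ^ n) with hB
  set g := gaussSum χ (traceChar F hζ.pow_eq_one) with hgdef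
  set g' := gaussSum χ⁻¹ (traceChar F hζ.pow_eq_one) with hgdef'
  have hδ' : gaussSum η (AddChar.zmodChar 499 hz'.pow_eq_one) = -δ := by
    linear_combination -hneg
  rw [hδ'] at hg'
  have hAB : A ^ 2 + 499 * B ^ 2 = 64 * 5 ^ f := by
    have : ((A ^ 2 + 499 * B ^ 2 : ℤ) : R) = ((64 * 5 ^ f : ℤ) : R) := by
      push_cast
      push_cast at hsq
      linear_combination (-(A + B * δ)) * hg' - 8 * g' * hg + 64 * hprod + B ^ 2 * hsq
    exact_mod_cast this
  have hAd : (5 : ℤ) ^ e ∣ A := by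
    refine int_dvd_of_cast_dvd h5R e A ?_
    have : (A : R) = 4 * (g + g') := by
      apply mul_left_cancel₀ (two_ne_zero (α := R))
      linear_combination -hg - hg'
    rw [this]
    exact (dvd_add hd hd').mul_left _
  have hBd : (5 : ℤ) ^ e ∣ B := by
    have h1 : (5 : ℤ) ^ e ∣ B * 499 := by
      refine int_dvd_of_cast_dvd h5R e _ ?_
      have : ((B * 499 : ℤ) : R) = (g - g') * (-4 * δ) := by
        apply mul_left_cancel₀ (two_ne_zero (α := R))
        push_cast
        push_cast at hsq
        linear_combination δ * hg - δ * hg' + 2 * B * hsq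
      rw [this]
      exact (dvd_sub hd hd').mul_right _
    refine IsCoprime.dvd_of_dvd_mul_right (IsCoprime.pow_left ?_) h1
    rw [Int.isCoprime_iff_gcd_eq_one]
    norm_num
  rcases eq_or_eq_neg_of_sq_add_eq he hAd hBd hAB with h | h
  · left; linarith
  · right; linarith

/-- Sums over windows of length `499 ^ n`. -/
theorem sum_window_eq_or {n N : ℕ} (hN : N = 499 ^ (n + 1)) {h : ZMod N → ℤ}
    (hinv : ∀ (i : ℕ) a, h (5 ^ i * a) = h a)
    (h2 : h 0 = h (499 ^ n) ∨ h 0 = h (-499 ^ n)) :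
    ∃ r s : ℤ, ∀ k : ℕ, ∑ i ∈ Finset.range (499 ^ n), h ((k + i : ℕ)) = r ∨
      ∑ i ∈ Finset.range (499 ^ n), h ((k + i : ℕ)) = s := by
  have hval : ∀ c : ℕ, h ((499 ^ n * c : ℕ)) = h (499 ^ n) ∨
      h ((499 ^ n * c : ℕ)) = h (-499 ^ n) := by
    intro c
    have h499 : ((499 ^ n * c : ℕ) : ZMod N) = ((499 ^ n * (c % 499) : ℕ) : ZMod N) := by
      rw [ZMod.natCast_eq_natCast_iff, hN, pow_succ]
      exact ((Nat.mod_modEq c 499).symm).mul_left' _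
    rw [h499]
    have hc := two_mul_invariant hN hinv (Nat.mod_lt c (by norm_num : 499 > 0))
    by_cases h0 : ((c % 499 : ℕ) : ZMod 499) = 0
    · rw [if_pos h0, h0, MulChar.map_zero] at hc
      omega
    · rw [if_neg h0] at hc
      rcases quadraticChar_dichotomy h0 with h1 | h1 <;> rw [h1] at hc <;> omega
  have hstep : ∀ k : ℕ, ∑ i ∈ Finset.range (499 ^ n), h ((k + 1 + i : ℕ)) =
      ∑ i ∈ Finset.range (499 ^ n), h ((k + i : ℕ)) - h k + h ((k + 499 ^ n : ℕ)) := by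
    intro k
    have h1 := Finset.sum_range_succ (fun i => h ((k + i : ℕ))) (499 ^ n)
    rw [Finset.sum_range_succ'] at h1
    simp only [add_zero] at h1
    have h3 : ∀ i, k + 1 + i = k + (i + 1) := fun i => by ring
    simp_rw [h3]
    linarith
  have hW : ∀ k : ℕ, ∃ c : ℕ, k ≤ 499 ^ n * c ∧ 499 ^ n * c < k + 499 ^ n ∧
      ∑ i ∈ Finset.range (499 ^ n), h ((k + i : ℕ)) =
        (∑ i ∈ Finset.range (499 ^ n), h i - h 0) + h ((499 ^ n * c : ℕ)) := by
    intro k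
    induction k with
    | zero => exact ⟨0, by simp⟩
    | succ k ih =>
      obtain ⟨c, hc1, hc2, hc⟩ := ih
      rw [hstep, hc]
      by_cases hk : 499 ^ n ∣ k
      · obtain ⟨d, rfl⟩ := hk
        have hcd : c = d := by
          have h3 : c < d + 1 := by
            rw [← Nat.mul_succ] at hc2
            exact Nat.lt_of_mul_lt_mul_left hc2
          have h4 := Nat.le_of_mul_le_mul_left hc1 (by positivity)
          omega
        subst hcd
        refine ⟨c + 1, ?_, ?_, ?_⟩
        · rw [mul_add, mul_one]
          exact Nat.add_le_add_left (Nat.one_le_pow _ _ (by norm_num)) _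
        · rw [mul_add]; omega
        · rw [mul_add, mul_one]; ring
      · refine ⟨c, ?_, by omega, ?_⟩
        · refine lt_of_le_of_ne hc1 ?_
          rintro rfl
          exact hk (dvd_mul_right _ _)
        · subst hN
          rw [invariant_add_period hinv hk]
          ring
  refine ⟨(∑ i ∈ Finset.range (499 ^ n), h i - h 0) + h (499 ^ n),
    (∑ i ∈ Finset.range (499 ^ n), h i - h 0) + h (-499 ^ n), fun k => ?_⟩
  obtain ⟨c, -, -, hc⟩ := hW k
  rw [hc]
  rcases hval c with h1 | h1
  · left; rw [h1]
  · right; rw [h1]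

end TwoValues

section CayleySRG

/-- A symmetric connection set with at most two nontrivial character values: the number of
representations of `w ≠ 0` as a sum of two elements depends only on whether `w ∈ D`. -/
theorem card_repr_eq_of_two_values {F R : Type} [Field F] [Fintype F] [CommRing R] [IsDomain R]
    [CharZero R] {ψ : AddChar F R} (hψ : ψ.IsPrimitive) (D : Set F) (r s : R)
    (h : ∀ b ≠ 0, 4 * ∑ d, (if d ∈ D then ψ (b * d) else 0) = r ∨
      4 * ∑ d, (if d ∈ D then ψ (b * d) else 0) = s)
    {w w' : F} (hw : w ≠ 0) (hw' : w' ≠ 0) (hww' : w ∈ D ↔ w' ∈ D) :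
    (Finset.univ.filter fun d => d ∈ D ∧ w - d ∈ D).card =
      (Finset.univ.filter fun d => d ∈ D ∧ w' - d ∈ D).card := by
  have hS : ∃ κ : R, ∀ b, 16 * (∑ d, (if d ∈ D then ψ (b * d) else 0)) ^ 2 =
      4 * (r + s) * (∑ d, (if d ∈ D then ψ (b * d) else 0)) - r * s + if b = 0 then κ else 0 := by
    refine ⟨16 * (∑ d, (if d ∈ D then ψ (0 * d) else 0)) ^ 2 -
      4 * (r + s) * (∑ d, (if d ∈ D then ψ (0 * d) else 0)) + r * s, fun b => ?_⟩
    split_ifs with hb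
    · rw [hb]; ring
    · rcases h b hb with h1 | h1 <;> rw [← h1] <;> ring
  obtain ⟨κ, hS⟩ := hS
  have key : ∀ v : F, v ≠ 0 →
      16 * ((Fintype.card F : R) * (Finset.univ.filter fun d => d ∈ D ∧ v - d ∈ D).card) =
        4 * (r + s) * (if v ∈ D then (Fintype.card F : R) else 0) + κ := by
    intro v hv
    have h1 : ∑ b, ψ (b * -v) = 0 := by
      rw [AddChar.sum_mulShift _ hψ, if_neg (neg_ne_zero.mpr hv), Nat.cast_zero]
    have h2 : ∑ b, (∑ d, (if d ∈ D then ψ (b * d) else 0)) * ψ (b * -v) =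
        if v ∈ D then (Fintype.card F : R) else 0 := by
      simp_rw [Finset.sum_mul]
      rw [Finset.sum_comm]
      have h3 : ∀ d, ∑ b, (if d ∈ D then ψ (b * d) else 0) * ψ (b * -v) =
          if d = v then (if v ∈ D then (Fintype.card F : R) else 0) else 0 := by
        intro d
        simp_rw [ite_mul, zero_mul, ← AddChar.map_add_eq_mul, ← mul_add]
        by_cases hd : d ∈ D
        · simp_rw [if_pos hd]
          rw [AddChar.sum_mulShift _ hψ]
          simp_rw [← sub_eq_add_neg, sub_eq_zero]
          by_cases hdv : d = v
          · subst hdv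
            rw [if_pos rfl, if_pos rfl, if_pos hd]
          · rw [if_neg hdv, if_neg hdv, Nat.cast_zero]
        · simp_rw [if_neg hd, Finset.sum_const_zero]
          by_cases hdv : d = v
          · subst hdv
            rw [if_pos rfl, if_neg hd]
          · rw [if_neg hdv]
      simp_rw [h3]
      rw [Finset.sum_ite_eq' Finset.univ v, if_pos (Finset.mem_univ _)]
    have h4 : ∑ b, (∑ d, (if d ∈ D then ψ (b * d) else 0)) ^ 2 * ψ (b * -v) =
        (Fintype.card F : R) * (Finset.univ.filter fun d => d ∈ D ∧ v - d ∈ D).card := by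
      simp_rw [pow_two, Finset.sum_mul_sum, Finset.sum_mul]
      rw [Finset.sum_comm, Finset.card_filter, Nat.cast_sum, Finset.mul_sum]
      refine Finset.sum_congr rfl fun d _ => ?_
      rw [Finset.sum_comm]
      have h5 : ∀ d', ∑ b, (if d ∈ D then ψ (b * d) else 0) * (if d' ∈ D then ψ (b * d') else 0) *
          ψ (b * -v) = if d' = v - d then (if d ∈ D ∧ v - d ∈ D then (Fintype.card F : R) else 0)
            else 0 := by
        intro d'
        by_cases hd : d ∈ D
        · by_cases hd' : d' ∈ D
          · simp_rw [if_pos hd, if_pos hd', ← AddChar.map_add_eq_mul, ← mul_add]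
            rw [AddChar.sum_mulShift _ hψ]
            have h6 : d + d' + -v = 0 ↔ d' = v - d := by
              rw [← sub_eq_add_neg, sub_eq_zero, eq_sub_iff_add_eq']
            by_cases hdv : d' = v - d
            · rw [if_pos (h6.mpr hdv), if_pos hdv, if_pos ⟨hd, hdv ▸ hd'⟩]
            · rw [if_neg (mt h6.mp hdv), if_neg hdv, Nat.cast_zero]
          · simp_rw [if_neg hd', mul_zero, zero_mul, Finset.sum_const_zero]
            by_cases hdv : d' = v - d
            · rw [if_pos hdv, if_neg fun hh => hd' (hdv ▸ hh.2)]
            · rw [if_neg hdv]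
        · simp [hd]
      simp_rw [h5]
      rw [Finset.sum_ite_eq' Finset.univ (v - d), if_pos (Finset.mem_univ _)]
      split_ifs <;> simp
    have h6 := Finset.sum_congr (rfl : (Finset.univ : Finset F) = _)
      fun b _ => congrArg (· * ψ (b * -v)) (hS b)
    simp only [add_mul, sub_mul, Finset.sum_add_distrib, Finset.sum_sub_distrib, mul_assoc,
      ← Finset.mul_sum, ite_mul, zero_mul] at h6
    rw [Finset.sum_ite_eq' Finset.univ (0 : F), if_pos (Finset.mem_univ _), h1, h2, h4, zero_mul,
      AddChar.map_zero_eq_one] at h6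
    linear_combination h6
  have hcard : (Fintype.card F : R) ≠ 0 := Nat.cast_ne_zero.mpr Fintype.card_ne_zero
  have h7 := (key w hw).trans ((congrArg (fun p : Prop => 4 * (r + s) *
    (if p then (Fintype.card F : R) else 0) + κ) (propext hww')).trans (key w' hw').symm)
  exact Nat.cast_injective
    (mul_left_cancel₀ hcard (mul_left_cancel₀ (by norm_num : (16 : R) ≠ 0) h7))

theorem isSRGWith_of_two_values {F R : Type} [Field F] [Fintype F] [CommRing R] [IsDomain R]
    [CharZero R] {ψ : AddChar F R} (hψ : ψ.IsPrimitive) {D : Set F} (hneg : ∀ x ∈ D, -x ∈ D)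
    (h0 : 0 ∉ D) {q k : ℕ} (hq : Fintype.card F = q)
    (hk : (Finset.univ.filter fun x => x ∈ D).card = k) (r s : R)
    (h : ∀ b ≠ 0, 4 * ∑ d, (if d ∈ D then ψ (b * d) else 0) = r ∨
      4 * ∑ d, (if d ∈ D then ψ (b * d) else 0) = s) :
    ∃ l u : ℕ, (SimpleGraph.fromRel (fun x y : F => x - y ∈ D)).IsSRGWith q k l u := by
  have hsub : ∀ {x y : F}, x - y ∈ D → y - x ∈ D := fun {x y} hxy => neg_sub x y ▸ hneg _ hxy
  have hadj : ∀ x y : F, (SimpleGraph.fromRel (fun x y : F => x - y ∈ D)).Adj x y ↔ x - y ∈ D := by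
    intro x y
    rw [SimpleGraph.fromRel_adj]
    refine ⟨fun hxy => hxy.2.elim id hsub, fun hxy => ⟨?_, Or.inl hxy⟩⟩
    rintro rfl
    exact h0 (sub_self x ▸ hxy)
  have hcommon : ∀ x y : F,
      Fintype.card ((SimpleGraph.fromRel (fun x y : F => x - y ∈ D)).commonNeighbors x y) =
        (Finset.univ.filter fun d => d ∈ D ∧ (x - y) - d ∈ D).card := by
    intro x y
    rw [← Set.toFinset_card]
    refine Finset.card_bij' (fun z _ => x - z) (fun d _ => x - d) ?_ ?_ ?_ ?_
    · intro z hz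
      rw [Set.mem_toFinset, SimpleGraph.mem_commonNeighbors, hadj, hadj] at hz
      rw [Finset.mem_filter]
      refine ⟨Finset.mem_univ _, hz.1, ?_⟩
      rw [sub_sub_sub_cancel_left]
      exact hsub hz.2
    · intro d hd
      rw [Finset.mem_filter] at hd
      rw [Set.mem_toFinset, SimpleGraph.mem_commonNeighbors, hadj, hadj]
      refine ⟨by rw [sub_sub_cancel]; exact hd.2.1, hsub ?_⟩
      rw [sub_right_comm]
      exact hd.2.2
    · intro z _
      exact sub_sub_cancel _ _
    · intro d _
      exact sub_sub_cancel _ _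
  have hconst : ∀ P : Prop, ∃ l : ℕ, ∀ w : F, w ≠ 0 → (w ∈ D ↔ P) →
      (Finset.univ.filter fun d => d ∈ D ∧ w - d ∈ D).card = l := by
    intro P
    by_cases hex : ∃ w : F, w ≠ 0 ∧ (w ∈ D ↔ P)
    · obtain ⟨w, hw, hwP⟩ := hex
      exact ⟨_, fun v hv hvP =>
        card_repr_eq_of_two_values hψ D r s h hv hw (hvP.trans hwP.symm)⟩
    · exact ⟨0, fun w hw hwP => absurd ⟨w, hw, hwP⟩ hex⟩
  obtain ⟨l, hl⟩ := hconst True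
  obtain ⟨u, hu⟩ := hconst False
  refine ⟨l, u, hq, fun x => ?_, fun x y hxy => ?_, fun x y hxy hnadj => ?_⟩
  · rw [← SimpleGraph.card_neighborFinset_eq_degree, ← hk]
    refine Finset.card_bij' (fun z _ => x - z) (fun d _ => x - d) ?_ ?_ ?_ ?_
    · intro z hz
      rw [SimpleGraph.mem_neighborFinset, hadj] at hz
      exact Finset.mem_filter.mpr ⟨Finset.mem_univ _, hz⟩
    · intro d hd
      rw [SimpleGraph.mem_neighborFinset, hadj, sub_sub_cancel]
      exact (Finset.mem_filter.mp hd).2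
    · intro z _
      exact sub_sub_cancel _ _
    · intro d _
      exact sub_sub_cancel _ _
  · rw [hcommon]
    exact hl _ (sub_ne_zero.mpr hxy.ne) (iff_true_intro ((hadj x y).mp hxy))
  · rw [hcommon]
    exact hu _ (sub_ne_zero.mpr hxy) (iff_false_intro (mt (hadj x y).mpr hnadj))

end CayleySRG

section CyclotomicUnion

theorem mem_cyclotomicUnion_iff {F : Type} [Field F] {N M : ℕ} {γ : Fˣ} (h0 : 0 < orderOf γ)
    (hN : N ∣ orderOf γ) {ℓ : Fˣ → ZMod N} (hpow : ∀ k : ℕ, ℓ (γ ^ k) = k)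
    (hgen : ∀ x : Fˣ, ∃ k : ℕ, x = γ ^ k) (a : ℕ) (x : Fˣ) :
    (∃ i < M, ∃ t : ℕ, (x : F) = (γ : F) ^ (i + a + N * t)) ↔
      ∃ i < M, ℓ x = ((i + a : ℕ) : ZMod N) := by
  refine exists_congr fun i => and_congr_right fun _ => ⟨?_, fun hx => ?_⟩
  · rintro ⟨t, ht⟩
    rw [← Units.val_pow_eq_pow_val, Units.val_inj] at ht
    rw [ht, hpow, Nat.cast_add, Nat.cast_mul, ZMod.natCast_self, zero_mul, add_zero]
  · obtain ⟨j, rfl⟩ := hgen x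
    have hle : i + a ≤ j + orderOf γ * (i + a) :=
      (Nat.le_mul_of_pos_left _ h0).trans (Nat.le_add_left _ _)
    rw [hpow, ZMod.natCast_eq_natCast_iff] at hx
    have hmod : i + a ≡ j + orderOf γ * (i + a) [MOD N] := by
      have h1 : orderOf γ * (i + a) ≡ 0 [MOD N] :=
        (Nat.modEq_zero_iff_dvd.mpr (hN.mul_right _))
      simpa using hx.symm.add h1.symm
    obtain ⟨t, ht⟩ := (Nat.modEq_iff_dvd' hle).mp hmod
    refine ⟨t, ?_⟩
    rw [← ht, Nat.add_sub_cancel' hle, pow_add, pow_mul, ← Units.val_pow_eq_pow_val γ (orderOf γ),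
      pow_orderOf_eq_one, Units.val_one, one_pow, mul_one, Units.val_pow_eq_pow_val]

theorem card_cyclotomicUnion {F : Type} [Field F] [Fintype F] {N M Q : ℕ} {γ : Fˣ} (hM : M ≤ N)
    (hQ : 0 < Q) (hγ : orderOf γ = N * Q) (a : ℕ) :
    (Finset.univ.filter fun x : F => ∃ i < M, ∃ t : ℕ, x = (γ : F) ^ (i + a + N * t)).card =
      M * Q := by
  have himage : (Finset.univ.filter fun x : F =>
      ∃ i < M, ∃ t : ℕ, x = (γ : F) ^ (i + a + N * t)) =
        (Finset.range M ×ˢ Finset.range Q).image fun p => (γ : F) ^ (p.1 + a + N * p.2) := by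
    ext x
    simp only [Finset.mem_filter, Finset.mem_univ, true_and, Finset.mem_image, Finset.mem_product,
      Finset.mem_range, Prod.exists]
    constructor
    · rintro ⟨i, hi, t, rfl⟩
      refine ⟨i, t % Q, ⟨hi, Nat.mod_lt _ hQ⟩, ?_⟩
      rw [← Units.val_pow_eq_pow_val, ← Units.val_pow_eq_pow_val, Units.val_inj,
        pow_eq_pow_iff_modEq, hγ]
      exact ((Nat.mod_modEq t Q).mul_left' N).add_left _
    · rintro ⟨i, t, ⟨hi, -⟩, rfl⟩
      exact ⟨i, hi, t, rfl⟩
  rw [himage, Finset.card_image_of_injOn, Finset.card_product, Finset.card_range, Finset.card_range]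
  rintro ⟨i, t⟩ hp ⟨i', t'⟩ hp' hpp'
  simp only [Finset.coe_product, Finset.coe_range, Set.mem_prod, Set.mem_Iio] at hp hp' hpp'
  have hbound : ∀ {i t : ℕ}, i < M → t < Q → i + N * t < N * Q := fun {i t} hi ht =>
    calc i + N * t < N * (t + 1) := by rw [mul_add]; omega
      _ ≤ N * Q := Nat.mul_le_mul_left _ ht
  rw [← Units.val_pow_eq_pow_val, ← Units.val_pow_eq_pow_val, Units.val_inj,
    pow_eq_pow_iff_modEq, hγ, add_right_comm, add_right_comm i'] at hpp'
  have h1 : i + N * t = i' + N * t' :=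
    (Nat.ModEq.add_right_cancel' a hpp').eq_of_lt_of_lt (hbound hp.1 hp.2) (hbound hp'.1 hp'.2)
  have h2 : i = i' := by
    have := congrArg (· % N) h1
    simp only [Nat.add_mul_mod_self_left] at this
    rwa [Nat.mod_eq_of_lt (hp.1.trans_le hM), Nat.mod_eq_of_lt (hp'.1.trans_le hM)] at this
  subst h2
  have hN : 0 < N := by omega
  rw [Nat.eq_of_mul_eq_mul_left hN (Nat.add_left_cancel h1)]

theorem four_mul_sum_cyclotomicUnion {F : Type} [Field F] [Fintype F] [Algebra (ZMod 5) F] {R : Type}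
    [CommRing R] [IsDomain R] {ζ : R} (hζ : IsPrimitiveRoot ζ 5) {N M : ℕ} (hM : M ≤ N)
    (h4 : IsUnit (4 : ZMod N)) {ℓ : Fˣ → ZMod N} (hℓ : ∀ x y, ℓ (x * y) = ℓ x + ℓ y) {D : Set F}
    (a : ℕ) (h0 : 0 ∉ D) (hD : ∀ x : Fˣ, (x : F) ∈ D ↔ ∃ i < M, ℓ x = ((i + a : ℕ) : ZMod N))
    (b : Fˣ) :
    4 * ∑ d, (if d ∈ D then traceChar F hζ.pow_eq_one (b * d) else 0) =
      ((∑ i ∈ Finset.range M, classSum ℓ (ℓ b + ((i + a : ℕ) : ZMod N)) : ℤ) : R) := by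
  have hunits : ∑ d, (if d ∈ D then traceChar F hζ.pow_eq_one (b * d) else 0) =
      ∑ x : Fˣ, (if (x : F) ∈ D then traceChar F hζ.pow_eq_one (b * x) else 0) := by
    rw [← Finset.sum_subset (Finset.subset_univ (Finset.univ.image (Units.val : Fˣ → F))),
      Finset.sum_image (fun x _ y _ hxy => Units.ext hxy)]
    intro x _ hx
    rw [if_neg]
    intro hxD
    have hx0 : x ≠ 0 := by rintro rfl; exact h0 hxD
    exact hx (Finset.mem_image_of_mem _ (Finset.mem_univ (Units.mk0 x hx0)))
  rw [hunits, Int.cast_sum]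
  simp_rw [← four_mul_sum_class_mul hζ h4 hℓ]
  rw [← Finset.mul_sum, Finset.sum_comm]
  congr 1
  refine Finset.sum_congr rfl fun x _ => ?_
  by_cases hx : (x : F) ∈ D
  · obtain ⟨i, hi, hxi⟩ := (hD x).mp hx
    rw [if_pos hx, Finset.sum_eq_single i, if_pos hxi]
    · intro j hj hji
      rw [if_neg]
      intro hxj
      rw [hxi, ZMod.natCast_eq_natCast_iff] at hxj
      exact hji ((Nat.ModEq.add_right_cancel' a hxj).eq_of_lt_of_lt (hi.trans_le hM)
        ((Finset.mem_range.mp hj).trans_le hM)).symm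
    · intro hi'
      exact absurd (Finset.mem_range.mpr hi) hi'
  · rw [if_neg hx, Finset.sum_eq_zero]
    intro i hi
    rw [if_neg]
    intro hxi
    exact hx ((hD x).mpr ⟨i, Finset.mem_range.mp hi, hxi⟩)

end CyclotomicUnion

/-- Each `Cay(F_q, D_k)` is a strongly regular graph of degree `(q-1)/499`,
where `q = 5^{249*499^(m-1)}`, `N = 499^m`. -/
theorem cayley_srg_example_17
    (m N q : ℕ) (hm : 1 ≤ m)
    (hN : N = 499 ^ m) (hq : q = 5 ^ (249 * 499 ^ (m - 1)))
    (F : Type) [Field F] [Fintype F] (hF : Fintype.card F = q)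
    (γ : Fˣ) (hγ : orderOf γ = q - 1)
    (D : ℕ → Set F)
    (hD : ∀ k, D k = {x : F | ∃ i < 499 ^ (m - 1), ∃ t : ℕ,
        x = ((γ : F)) ^ (i + k * 499 ^ (m - 1) + N * t)}) :
    ∀ k ≤ 498,
      SimpleGraph.fromRel (fun x y : F => x - y ∈ D k) ≠ ⊤ ∧
      SimpleGraph.fromRel (fun x y : F => x - y ∈ D k) ≠ ⊥ ∧
      ∃ l u : ℕ, (SimpleGraph.fromRel (fun x y : F => x - y ∈ D k)).IsSRGWith
        q ((q - 1) / 499) l u := by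
  intro k _
  obtain ⟨n, rfl⟩ : ∃ n, m = n + 1 := ⟨m - 1, by omega⟩
  rw [Nat.add_sub_cancel] at hq hD
  obtain ⟨f, hf⟩ : ∃ f, f = 249 * 499 ^ n := ⟨_, rfl⟩
  rw [← hf] at hq
  obtain ⟨e, he⟩ : ∃ e, f = 2 * e + 3 := by
    have hodd : Odd f := hf ▸ Odd.mul (by decide) (Odd.pow (by decide))
    have hpos : 0 < 499 ^ n := by positivity
    obtain ⟨d, hd⟩ := hodd
    exact ⟨d - 1, by omega⟩
  have : CharP F 5 := charP_of_card_eq_prime_pow (hF.trans hq)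
  let _ : Algebra (ZMod 5) F := ZMod.algebra F 5
  have hgen : ∀ x : Fˣ, ∃ j : ℕ, x = γ ^ j := by
    intro x
    have hx : x ∈ Subgroup.zpowers γ := by
      rw [Subgroup.eq_top_of_card_eq (Subgroup.zpowers γ)]
      · trivial
      · rw [Nat.card_zpowers, hγ, Nat.card_eq_fintype_card, Fintype.card_units, hF]
    obtain ⟨j, hj⟩ := mem_zpowers_iff_mem_range_orderOf.mp hx |> Finset.mem_image.mp
    exact ⟨j, hj.2.symm⟩
  have hdvd : N ∣ q - 1 := by
    obtain ⟨⟨s, hs, -⟩, -⟩ := exists_digits_both n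
    rw [← hf, ← hN, ← hq] at hs
    exact ⟨_, hs⟩
  have hcop : ∀ a : ℕ, Nat.Coprime a 499 → IsUnit (a : ZMod N) := fun a ha => by
    rw [ZMod.isUnit_iff_coprime, hN]
    exact ha.pow_right _
  have h2 : IsUnit (2 : ZMod N) := hcop 2 (by norm_num)
  have h4 : IsUnit (4 : ZMod N) := hcop 4 (by norm_num)
  have h5 : IsUnit (5 : ZMod N) := hcop 5 (by norm_num)
  have hMN : N = 499 ^ n * 499 := hN.trans (pow_succ _ _)
  have hM0 : 0 < 499 ^ n := by positivity
  have hq1 : 1 < q := hF ▸ Fintype.one_lt_card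
  obtain ⟨ℓ, hℓ, hpow⟩ := exists_log_mod γ (hγ ▸ hdvd) hgen
  obtain ⟨r, s, hrs⟩ := sum_window_eq_or hN (classSum_five_pow_mul h5 hℓ)
    (classSum_zero_eq_or hf hN he (hF.trans hq) (hq ▸ hγ) hℓ hpow hgen h5 h4)
  have hmem : ∀ x : Fˣ, (x : F) ∈ D k ↔
      ∃ i < 499 ^ n, ℓ x = ((i + k * 499 ^ n : ℕ) : ZMod N) := fun x => by
    rw [hD]
    exact mem_cyclotomicUnion_iff (by omega) (hγ ▸ hdvd) hpow hgen _ x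
  have h0 : (0 : F) ∉ D k := by
    rw [hD]
    rintro ⟨i, -, t, ht⟩
    exact pow_ne_zero _ γ.ne_zero ht.symm
  have hℓneg : ℓ (-1) = 0 := by
    have h1 := hℓ (-1) (-1)
    have h3 := hℓ 1 1
    rw [neg_mul_neg, one_mul] at h1
    rw [one_mul] at h3
    refine h2.mul_left_cancel ?_
    linear_combination h3 - h1 - 2 * h3
  have hneg : ∀ x ∈ D k, -x ∈ D k := by
    intro x hx
    have hx0 : x ≠ 0 := by rintro rfl; exact h0 hx
    have h1 := (hmem (Units.mk0 x hx0)).mp hx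
    have h3 : ((-1 * Units.mk0 x hx0 : Fˣ) : F) ∈ D k := by
      rw [hmem, hℓ, hℓneg, zero_add]
      exact h1
    simpa using h3
  refine ⟨?_, ?_, ?_⟩
  · intro htop
    have h1 : (SimpleGraph.fromRel (fun x y : F => x - y ∈ D k)).Adj
        ((γ ^ (499 ^ n + k * 499 ^ n) : Fˣ) : F) 0 := by
      rw [htop]; exact Units.ne_zero _
    rw [SimpleGraph.fromRel_adj, sub_zero, zero_sub] at h1
    have h3 : ((γ ^ (499 ^ n + k * 499 ^ n) : Fˣ) : F) ∈ D k :=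
      h1.2.elim id fun h => neg_neg ((γ ^ (499 ^ n + k * 499 ^ n) : Fˣ) : F) ▸ hneg _ h
    obtain ⟨i, hi, h6⟩ := (hmem _).mp h3
    rw [hpow, ZMod.natCast_eq_natCast_iff] at h6
    have := (Nat.ModEq.add_right_cancel' _ h6).eq_of_lt_of_lt (by omega) (by omega)
    omega
  · intro hbot
    have h1 : (SimpleGraph.fromRel (fun x y : F => x - y ∈ D k)).Adj
        ((γ ^ (0 + k * 499 ^ n) : Fˣ) : F) 0 := by
      rw [SimpleGraph.fromRel_adj, sub_zero]
      exact ⟨Units.ne_zero _, Or.inl ((hmem _).mpr ⟨0, hM0, hpow _⟩)⟩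
    rw [hbot] at h1
    exact h1
  · obtain ⟨Q, hQ⟩ := hdvd
    have hζ := Complex.isPrimitiveRoot_exp 5 (by norm_num)
    refine isSRGWith_of_two_values (traceChar_isPrimitive hζ) hneg h0 hF ?_ (r : ℂ) (s : ℂ) ?_
    · have hQ0 : 0 < Q := Nat.pos_of_ne_zero (by rintro rfl; omega)
      rw [hQ, show N * Q / 499 = 499 ^ n * Q by
        rw [hMN, mul_right_comm, Nat.mul_div_cancel _ (by norm_num)]]
      simp only [hD, Set.mem_ofPred_eq]
      exact card_cyclotomicUnion (by omega) hQ0 (hγ.trans hQ) (k * 499 ^ n)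
    · intro b hb
      obtain ⟨j, hj⟩ := hgen (Units.mk0 b hb)
      have hS := four_mul_sum_cyclotomicUnion (M := 499 ^ n) hζ (by omega) h4 hℓ _ h0 hmem (Units.mk0 b hb)
      rw [Units.val_mk0] at hS
      rw [hS, Int.cast_inj, Int.cast_inj, hj, hpow]
      convert hrs (j + k * 499 ^ n) using 5 <;> (push_cast; ring)
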